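/- Let n ≥ 5, set d = n(2n+1), let a_j = n−j+1/2 for 1 ≤ j ≤ n, let ρ = (n−1/2, n−3/2, …, 1/2) ∈ ℝⁿ, and define the multiplicity polynomial m(x) = (∏_{i=1}^n x_i²) ∏_{1≤i<l≤n} (x_i² − x_l²)² / ((∏_{j=1}^n a_j²) ∏_{1≤j<l≤n} (a_j² − a_l²)²). Define, for λ > 0, 𝓝(λ) = (1/(2^{n} n!)) Σ_{b∈ℤⁿ} m(b+ρ) · 1_{|b+ρ|² ≤ λ + |ρ|²}. Then as λ → ∞, 𝓝(λ) = C λ^{d/2} + O(λ^{(d−2)/2}), where C = (1/(2^{n} n!)) ∫_{|x|≤1} m(x) dx. -/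

import Mathlib

open MeasureTheory Filter Asymptotics Finset

lemma pow_mul_exp_neg_le (k : ℕ) {ε t : ℝ} (hε : 0 < ε) (ht : 0 < t) :
    t ^ k * Real.exp (-ε * t) ≤ ((k + 1).factorial / ε ^ (k + 1)) * (1 / t) := by
  have h := Real.pow_div_factorial_le_exp (ε * t) (by positivity) (k + 1)
  have h2 : Real.exp (-ε * t) = (Real.exp (ε * t))⁻¹ := by rw [← Real.exp_neg]; ring_nf
  have he := Real.exp_pos (ε * t)
  rw [h2, div_mul_div_comm, mul_one, ← div_eq_mul_inv, div_le_div_iff₀ he (by positivity)]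
  rw [div_le_iff₀ (by positivity)] at h
  calc t ^ k * (ε ^ (k + 1) * t) = (ε * t) ^ (k + 1) := by ring
    _ ≤ _ := by linarith

lemma half_ne_zero (b : ℤ) : (b : ℝ) + 1 / 2 ≠ 0 := by
  intro h
  have : ((2 * b + 1 : ℤ) : ℝ) = 0 := by push_cast; linarith
  have := Int.cast_eq_zero.mp this
  omega

lemma summable_half_pow_mul_exp (k : ℕ) {ε : ℝ} (hε : 0 < ε) :
    Summable fun b : ℤ => (((b : ℝ) + 1 / 2) ^ 2) ^ k * Real.exp (-ε * ((b : ℝ) + 1 / 2) ^ 2) := by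
  have h := (Real.summable_one_div_int_add_rpow (1 / 2) 2).mpr (by norm_num)
  refine Summable.of_nonneg_of_le (fun b => by positivity) (fun b => ?_)
    (h.mul_left ((k + 1).factorial / ε ^ (k + 1) : ℝ))
  have := pow_mul_exp_neg_le k hε (t := ((b : ℝ) + 1 / 2) ^ 2)
    (by have := half_ne_zero b; positivity)
  refine this.trans (le_of_eq ?_)
  congr 2
  rw [Real.rpow_two, sq_abs]

/-- The moments `∑ x ^ (2 k) exp (-w x²)` of the theta series over `ℤ + 1/2`. -/
noncomputable def halfTheta (k : ℕ) (w : ℂ) : ℂ :=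
  ∑' b : ℤ, (((b : ℂ) + 1 / 2) ^ 2) ^ k * Complex.exp (-w * ((b : ℂ) + 1 / 2) ^ 2)

lemma norm_halfTheta_term (k : ℕ) (w : ℂ) (b : ℤ) :
    ‖(((b : ℂ) + 1 / 2) ^ 2) ^ k * Complex.exp (-w * ((b : ℂ) + 1 / 2) ^ 2)‖ =
      (((b : ℝ) + 1 / 2) ^ 2) ^ k * Real.exp (-w.re * ((b : ℝ) + 1 / 2) ^ 2) := by
  have h : ((b : ℂ) + 1 / 2) ^ 2 = ((((b : ℝ) + 1 / 2) ^ 2 : ℝ) : ℂ) := by push_cast; rfl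
  rw [h, norm_mul, Complex.norm_exp, norm_pow, Complex.norm_real, Real.norm_eq_abs,
    abs_of_nonneg (sq_nonneg _), Complex.re_mul_ofReal, Complex.neg_re]

lemma summable_halfTheta (k : ℕ) {w : ℂ} (hw : 0 < w.re) :
    Summable fun b : ℤ =>
      (((b : ℂ) + 1 / 2) ^ 2) ^ k * Complex.exp (-w * ((b : ℂ) + 1 / 2) ^ 2) := by
  refine Summable.of_norm ?_
  simp_rw [norm_halfTheta_term]
  exact summable_half_pow_mul_exp k hw

lemma hasDerivAt_halfTheta (k : ℕ) {w : ℂ} (hw : 0 < w.re) :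
    HasDerivAt (halfTheta k) (-halfTheta (k + 1) w) w := by
  set U : Set ℂ := {z | w.re / 2 < z.re} with hU
  have hUo : IsOpen U := isOpen_lt continuous_const Complex.continuous_re
  have hwU : w ∈ U := by simp only [hU, Set.mem_ofPred_eq]; linarith
  have hd : ∀ (b : ℤ) (z : ℂ), HasDerivAt (fun z : ℂ =>
      (((b : ℂ) + 1 / 2) ^ 2) ^ k * Complex.exp (-z * ((b : ℂ) + 1 / 2) ^ 2))
      (-((((b : ℂ) + 1 / 2) ^ 2) ^ (k + 1) * Complex.exp (-z * ((b : ℂ) + 1 / 2) ^ 2))) z := by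
    intro b z
    have h1 : HasDerivAt (fun z : ℂ => -z * ((b : ℂ) + 1 / 2) ^ 2)
        (-1 * ((b : ℂ) + 1 / 2) ^ 2) z := (hasDerivAt_id z).neg.mul_const _
    have := (h1.cexp).const_mul ((((b : ℂ) + 1 / 2) ^ 2) ^ k)
    exact this.congr_deriv (by ring)
  have hbd : ∀ (b : ℤ) (z : ℂ), z ∈ U →
      ‖(((b : ℂ) + 1 / 2) ^ 2) ^ k * Complex.exp (-z * ((b : ℂ) + 1 / 2) ^ 2)‖ ≤
      (((b : ℝ) + 1 / 2) ^ 2) ^ k * Real.exp (-(w.re / 2) * ((b : ℝ) + 1 / 2) ^ 2) := by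
    intro b z hz
    rw [norm_halfTheta_term]
    simp only [hU, Set.mem_ofPred_eq] at hz
    gcongr
  have hsum := summable_half_pow_mul_exp k (ε := w.re / 2) (by linarith)
  have hdiff := Complex.differentiableOn_tsum_of_summable_norm hsum
    (fun b z _ => (hd b z).differentiableAt.differentiableWithinAt) hUo hbd
  have hder := Complex.hasSum_deriv_of_summable_norm hsum
    (fun b z _ => (hd b z).differentiableAt.differentiableWithinAt) hUo hbd hwU
  have hat := (hdiff.differentiableAt (hUo.mem_nhds hwU)).hasDerivAt
  have heq : deriv (fun w => ∑' b : ℤ,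
      (((b : ℂ) + 1 / 2) ^ 2) ^ k * Complex.exp (-w * ((b : ℂ) + 1 / 2) ^ 2)) w =
      -halfTheta (k + 1) w := by
    rw [← hder.tsum_eq, halfTheta, ← tsum_neg]
    exact tsum_congr fun b => (hd b w).deriv
  rw [heq] at hat
  exact hat

/-- Cauchy's estimate along a sequence of functions, each minus the derivative of the previous. -/
lemma norm_le_of_hasDerivAt_neg {f : ℕ → ℂ → ℂ} {U : Set ℂ} (hU : IsOpen U)
    (hf : ∀ k, ∀ z ∈ U, HasDerivAt (f k) (-f (k + 1) z) z) {c : ℂ} {R B : ℝ} (hR : 0 < R)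
    (hc : Metric.closedBall c R ⊆ U) (hB : ∀ z ∈ Metric.closedBall c R, ‖f 0 z‖ ≤ B) (k : ℕ) :
    ‖f k c‖ ≤ k.factorial * B / R ^ k := by
  have hit : ∀ k, ∀ z ∈ U, iteratedDeriv k (f 0) z = (-1) ^ k * f k z := by
    intro k
    induction k with
    | zero => intro z _; simp
    | succ k ih =>
      intro z hz
      rw [iteratedDeriv_succ]
      have : iteratedDeriv k (f 0) =ᶠ[nhds z] fun z => (-1) ^ k * f k z :=
        Filter.eventuallyEq_of_mem (hU.mem_nhds hz) ih
      rw [this.deriv_eq, ((hf k z hz).const_mul _).deriv]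
      ring
  have hcU : c ∈ U := hc (Metric.mem_closedBall_self hR.le)
  have hdiff : DiffContOnCl ℂ (f 0) (Metric.ball c R) := by
    refine DifferentiableOn.diffContOnCl fun z hz => ?_
    exact (hf 0 z (hc (Metric.closure_ball_subset_closedBall hz))).differentiableAt.differentiableWithinAt
  have := Complex.norm_iteratedDeriv_le_of_forall_mem_sphere_norm_le k hR hdiff
    (fun z hz => hB z (Metric.sphere_subset_closedBall hz))
  rw [hit k c hcU, norm_mul, norm_pow, norm_neg, norm_one, one_pow, one_mul] at this
  exact this

lemma card_two_mul_eq_zero_le (q : ℕ) [NeZero q] :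
    (Finset.univ.filter fun t : ZMod q => 2 * t = 0).card ≤ 2 := by
  have hsub : (Finset.univ.filter fun t : ZMod q => 2 * t = 0) ⊆ {0, ((q / 2 : ℕ) : ZMod q)} := by
    intro t ht
    simp only [Finset.mem_filter, Finset.mem_univ, true_and] at ht
    have h1 : ((2 * t.val : ℕ) : ZMod q) = 0 := by
      push_cast
      rw [ZMod.natCast_zmod_val]
      exact ht
    rw [ZMod.natCast_eq_zero_iff] at h1
    have h2 := ZMod.val_lt t
    obtain ⟨c, hc⟩ := h1
    have hc2 : c < 2 := by
      by_contra h
      have : q * 2 ≤ q * c := Nat.mul_le_mul_left _ (by omega)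
      omega
    have h3 : t.val = 0 ∨ t.val = q / 2 := by
      interval_cases c <;> omega
    rw [Finset.mem_insert, Finset.mem_singleton, ← ZMod.natCast_zmod_val t]
    rcases h3 with h | h <;> rw [h] <;> simp
  exact (Finset.card_le_card hsub).trans Finset.card_le_two

/-- Quadratic Gauss sums with a linear term satisfy `‖G‖² ≤ 2 q`. -/
lemma norm_sq_gaussSum_quadratic_le (q : ℕ) [NeZero q] (ψ : AddChar (ZMod q) ℂ)
    (hψ : ψ.IsPrimitive) {a : ZMod q} (ha : IsUnit a) (c : ZMod q) :
    ‖∑ r : ZMod q, ψ (a * r ^ 2 + c * r)‖ ^ 2 ≤ 2 * q := by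
  have hnorm : ∀ x, ‖ψ x‖ = 1 := fun x => ψ.norm_apply x
  have key : ((‖∑ r : ZMod q, ψ (a * r ^ 2 + c * r)‖ ^ 2 : ℝ) : ℂ) =
      ∑ t : ZMod q, ψ (a * t ^ 2 + c * t) * (if 2 * a * t = 0 then (q : ℂ) else 0) := by
    push_cast
    rw [← Complex.conj_mul', map_sum, Finset.sum_mul_sum]
    calc _ = ∑ s : ZMod q, ∑ t : ZMod q, ψ (a * t ^ 2 + c * t) * ψ (s * (2 * a * t)) := by
            refine Finset.sum_congr rfl fun s _ => ?_
            rw [← Equiv.sum_comp (Equiv.addLeft s)]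
            refine Finset.sum_congr rfl fun t _ => ?_
            rw [← ψ.map_neg_eq_conj, ← ψ.map_add_eq_mul, ← ψ.map_add_eq_mul, Equiv.coe_addLeft]
            congr 1
            ring
      _ = _ := by
            rw [Finset.sum_comm]
            refine Finset.sum_congr rfl fun t _ => ?_
            rw [← Finset.mul_sum, AddChar.sum_mulShift _ hψ]
            simp [ZMod.card]
  have h2 : ‖((‖∑ r : ZMod q, ψ (a * r ^ 2 + c * r)‖ ^ 2 : ℝ) : ℂ)‖ ≤
      ∑ t : ZMod q, (if 2 * t = 0 then (q : ℝ) else 0) := by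
    rw [key]
    refine (norm_sum_le _ _).trans (Finset.sum_le_sum fun t _ => ?_)
    have : 2 * a * t = 0 ↔ 2 * t = 0 := by
      rw [show 2 * a * t = a * (2 * t) by ring]
      exact ha.mul_right_eq_zero
    rw [norm_mul, hnorm, one_mul, if_congr this rfl rfl]
    split_ifs <;> simp
  rw [Complex.norm_real, Real.norm_of_nonneg (by positivity)] at h2
  refine h2.trans ?_
  rw [← Finset.sum_filter, Finset.sum_const, nsmul_eq_mul]
  have := card_two_mul_eq_zero_le q
  gcongr
  exact_mod_cast this

lemma summable_int_exp_neg_mul_sq {y : ℝ} (hy : 0 < y) :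
    Summable fun n : ℤ => Real.exp (-y * (n : ℝ) ^ 2) := by
  have := (summable_pow_mul_jacobiTheta₂_term_bound 0 (T := y / Real.pi) (by positivity) 0)
  refine this.congr fun n => ?_
  simp only [pow_zero, one_mul]
  congr 1
  field_simp
  simp

/-- The constant `∑ 1 / n²` over nonzero integers. -/
noncomputable def sqInvSum : ℝ := ∑' n : ℤ, 1 / (n : ℝ) ^ 2

lemma summable_sq_inv : Summable fun n : ℤ => 1 / (n : ℝ) ^ 2 := by
  have := (Real.summable_one_div_int_pow (p := 2)).mpr (by norm_num)
  exact this

lemma sqInvSum_nonneg : 0 ≤ sqInvSum := tsum_nonneg fun n => by positivity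

lemma tsum_int_exp_ne_zero_le {y : ℝ} (hy : 0 < y) :
    ∑' n : ℤ, (if n = 0 then 0 else Real.exp (-y * (n : ℝ) ^ 2)) ≤ sqInvSum / y := by
  rw [sqInvSum, ← tsum_div_const]
  have hle : ∀ n : ℤ, (if n = 0 then 0 else Real.exp (-y * (n : ℝ) ^ 2)) ≤ 1 / (n : ℝ) ^ 2 / y := by
    intro n
    split_ifs with h
    · positivity
    · have hn : 0 < (n : ℝ) ^ 2 := by positivity
      have := pow_mul_exp_neg_le 0 hy hn
      simp only [pow_zero, one_mul, zero_add, Nat.factorial_one, Nat.cast_one, pow_one] at this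
      refine this.trans (le_of_eq (by ring))
  refine Summable.tsum_le_tsum hle ?_ (summable_sq_inv.div_const y)
  exact Summable.of_nonneg_of_le (fun n => by split_ifs <;> positivity) hle
    (summable_sq_inv.div_const y)

lemma tsum_int_exp_le {y : ℝ} (hy : 0 < y) :
    ∑' n : ℤ, Real.exp (-y * (n : ℝ) ^ 2) ≤ 1 + sqInvSum / y := by
  rw [(summable_int_exp_neg_mul_sq hy).tsum_eq_add_tsum_ite 0]
  have := tsum_int_exp_ne_zero_le hy
  simp only [Int.cast_zero, ne_eq, OfNat.ofNat_ne_zero, not_false_eq_true, zero_pow, mul_zero,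
    Real.exp_zero]
  linarith

open Real in
lemma tsum_exp_neg_mul_progression {u : ℂ} (hu : 0 < u.re) {q : ℕ} (hq : 0 < q) (s : ℂ) :
    ∑' m : ℤ, Complex.exp (-u * (m * q + s) ^ 2) =
      1 / (u * q ^ 2 / π) ^ (1 / 2 : ℂ) * ∑' n : ℤ,
        Complex.exp (-(π ^ 2 / (q ^ 2 * u)) * n ^ 2) * Complex.exp (2 * π * Complex.I * n * s / q) := by
  have hu0 : u ≠ 0 := by rintro rfl; simp at hu
  have hq0 : (q : ℂ) ≠ 0 := by exact_mod_cast hq.ne'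
  have hπ : (π : ℂ) ≠ 0 := by exact_mod_cast pi_pos.ne'
  have hA : 0 < (u * q ^ 2 / π).re := by
    have : u * q ^ 2 / π = u * ((q ^ 2 / π : ℝ) : ℂ) := by push_cast; ring
    rw [this, Complex.re_mul_ofReal]
    positivity
  have h := Complex.tsum_exp_neg_quadratic hA (-u * q * s / π)
  have h1 : ∀ m : ℤ, Complex.exp (-u * (m * q + s) ^ 2) = Complex.exp (-u * s ^ 2) *
      Complex.exp (-π * (u * q ^ 2 / π) * m ^ 2 + 2 * π * (-u * q * s / π) * m) := by
    intro m
    rw [← Complex.exp_add]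
    congr 1
    field_simp
    ring
  simp_rw [h1]
  rw [tsum_mul_left, h, mul_left_comm, ← tsum_mul_left]
  congr 1
  refine tsum_congr fun n => ?_
  rw [← Complex.exp_add, ← Complex.exp_add]
  congr 1
  field_simp
  ring_nf
  simp only [Complex.I_sq]
  ring

open Real in
lemma re_pi_sq_div {u : ℂ} {q : ℕ} :
    (π ^ 2 / (q ^ 2 * u)).re = π ^ 2 * u.re / (q ^ 2 * ‖u‖ ^ 2) := by
  have : (π : ℂ) ^ 2 / (q ^ 2 * u) = ((π ^ 2 / q ^ 2 : ℝ) : ℂ) * u⁻¹ := by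
    push_cast; rw [← div_div, div_eq_mul_inv _ u]
  rw [this, Complex.re_ofReal_mul, Complex.inv_re, Complex.normSq_eq_norm_sq, div_mul_div_comm]

open Real in
lemma re_pi_sq_div_pos {u : ℂ} (hu : 0 < u.re) {q : ℕ} (hq : 0 < q) :
    0 < (π ^ 2 / (q ^ 2 * u)).re := by
  have hu0 : u ≠ 0 := by rintro rfl; simp at hu
  rw [re_pi_sq_div]
  positivity

lemma norm_exp_neg_mul_int_sq (z : ℂ) (n : ℤ) :
    ‖Complex.exp (-z * n ^ 2)‖ = Real.exp (-z.re * (n : ℝ) ^ 2) := by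
  have : (n : ℂ) ^ 2 = (((n : ℝ) ^ 2 : ℝ) : ℂ) := by push_cast; rfl
  rw [Complex.norm_exp, this, Complex.re_mul_ofReal, Complex.neg_re]

lemma exists_residue_quotient_equiv (q : ℕ) [NeZero q] :
    ∃ e : ZMod q × ℤ ≃ ℤ, ∀ r m, e (r, m) = m * q + r.val := by
  have hq : 0 < q := Nat.pos_of_ne_zero (NeZero.ne q)
  refine ⟨{ toFun := fun p => p.2 * q + p.1.val
            invFun := fun b => (b, b / q)
            left_inv := ?_
            right_inv := ?_ }, fun r m => rfl⟩
  · rintro ⟨r, m⟩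
    have hlt : (r.val : ℤ) < q := by exact_mod_cast ZMod.val_lt r
    refine Prod.ext ?_ ?_
    · simp
    · change (m * q + (r.val : ℤ)) / (q : ℤ) = m
      rw [add_comm, Int.add_mul_ediv_right _ _ (by exact_mod_cast hq.ne'),
        Int.ediv_eq_zero_of_lt (by positivity) hlt, zero_add]
  · intro b
    simp only [ZMod.val_intCast]
    exact Int.ediv_mul_add_emod b q

open Real in
lemma halfTheta_zero_add_rat {u : ℂ} (hu : 0 < u.re) (q : ℕ) [NeZero q] (a : ℤ) :
    halfTheta 0 (u + 2 * π * Complex.I * a / q) =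
      Complex.exp (-(π * Complex.I * a / (2 * q))) * (1 / (u * q ^ 2 / π) ^ (1 / 2 : ℂ)) *
      ∑' n : ℤ, Complex.exp (-(π ^ 2 / (q ^ 2 * u)) * n ^ 2) *
        Complex.exp (π * Complex.I * n / q) *
        ∑ r : ZMod q, ZMod.stdAddChar ((-(a : ZMod q)) * r ^ 2 + (-(a : ZMod q) + (n : ZMod q)) * r) := by
  have hq : 0 < q := Nat.pos_of_ne_zero (NeZero.ne q)
  have hu0 : u ≠ 0 := by rintro rfl; simp at hu
  have hq0 : (q : ℂ) ≠ 0 := by exact_mod_cast hq.ne'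
  have hw : 0 < (u + 2 * π * Complex.I * a / q).re := by
    have : 2 * π * Complex.I * a / q = ((2 * π * a / q : ℝ) : ℂ) * Complex.I := by push_cast; ring
    rw [this, Complex.add_re, Complex.re_ofReal_mul, Complex.I_re, mul_zero, add_zero]
    exact hu
  have hsum := summable_halfTheta 0 hw
  have hval : ∀ r : ZMod q, ((r.val : ℤ) : ZMod q) = r := fun r => by
    rw [Int.cast_natCast, ZMod.natCast_zmod_val]
  obtain ⟨e, he⟩ := exists_residue_quotient_equiv q
  rw [halfTheta, ← e.tsum_eq, Summable.tsum_prod (by exact e.summable_iff.mpr hsum), tsum_fintype]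
  have hterm : ∀ r : ZMod q, ∀ m : ℤ,
      (((e (r, m) : ℤ) : ℂ) + 1 / 2) ^ 2 = (m * q + ((r.val : ℂ) + 1 / 2)) ^ 2 := by
    intro r m
    rw [he]; push_cast; ring
  have hterm2 : ∀ r : ZMod q, ∀ m : ℤ,
      ((((e (r, m) : ℤ) : ℂ) + 1 / 2) ^ 2) ^ 0 * Complex.exp (-(u + 2 * π * Complex.I * a / q) *
        (((e (r, m) : ℤ) : ℂ) + 1 / 2) ^ 2) =
      (Complex.exp (-(π * Complex.I * a / (2 * q))) *
        ZMod.stdAddChar ((-(a : ZMod q)) * r ^ 2 + (-(a : ZMod q)) * r)) *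
      Complex.exp (-u * (m * q + ((r.val : ℂ) + 1 / 2)) ^ 2) := by
    intro r m
    have hψ : ZMod.stdAddChar ((-(a : ZMod q)) * r ^ 2 + (-(a : ZMod q)) * r) =
        Complex.exp (2 * π * Complex.I * ((-a * (e (r, m) ^ 2 + e (r, m)) : ℤ) : ℂ) / q) := by
      rw [← ZMod.stdAddChar_coe]
      congr 1
      rw [he]
      push_cast
      rw [ZMod.natCast_self, ZMod.natCast_zmod_val]
      ring
    rw [pow_zero, one_mul, hψ, ← hterm, ← Complex.exp_add, ← Complex.exp_add]
    congr 1
    push_cast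
    field_simp
    ring
  simp_rw [hterm2, tsum_mul_left, tsum_exp_neg_mul_progression hu hq]
  have hsummable : ∀ r : ZMod q, Summable fun n : ℤ =>
      Complex.exp (-(π ^ 2 / (q ^ 2 * u)) * n ^ 2) *
        Complex.exp (2 * π * Complex.I * n * ((r.val : ℂ) + 1 / 2) / q) := by
    intro r
    refine Summable.of_norm ?_
    refine (summable_int_exp_neg_mul_sq (re_pi_sq_div_pos hu hq)).congr fun n => ?_
    rw [norm_mul, norm_exp_neg_mul_int_sq,
      show 2 * π * Complex.I * n * ((r.val : ℂ) + 1 / 2) / q =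
        ((2 * π * n * ((r.val : ℝ) + 1 / 2) / q : ℝ) : ℂ) * Complex.I by push_cast; ring,
      Complex.norm_exp_ofReal_mul_I, mul_one]
  have hmul : ∀ r : ZMod q, (Complex.exp (-(π * Complex.I * a / (2 * q))) *
        ZMod.stdAddChar ((-(a : ZMod q)) * r ^ 2 + (-(a : ZMod q)) * r)) *
      (1 / (u * q ^ 2 / π) ^ (1 / 2 : ℂ) * ∑' n : ℤ,
        Complex.exp (-(π ^ 2 / (q ^ 2 * u)) * n ^ 2) *
        Complex.exp (2 * π * Complex.I * n * ((r.val : ℂ) + 1 / 2) / q)) =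
      Complex.exp (-(π * Complex.I * a / (2 * q))) * (1 / (u * q ^ 2 / π) ^ (1 / 2 : ℂ)) *
        ∑' n : ℤ, ZMod.stdAddChar ((-(a : ZMod q)) * r ^ 2 + (-(a : ZMod q)) * r) *
        (Complex.exp (-(π ^ 2 / (q ^ 2 * u)) * n ^ 2) *
        Complex.exp (2 * π * Complex.I * n * ((r.val : ℂ) + 1 / 2) / q)) := by
    intro r
    rw [tsum_mul_left]
    ring
  simp_rw [hmul]
  rw [← Finset.mul_sum, ← Summable.tsum_finsetSum fun r _ => (hsummable r).mul_left _]
  congr 1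
  refine tsum_congr fun n => ?_
  rw [Finset.mul_sum]
  refine Finset.sum_congr rfl fun r _ => ?_
  have hψ : ZMod.stdAddChar ((n : ZMod q) * r) =
      Complex.exp (2 * π * Complex.I * ((n * r.val : ℤ) : ℂ) / q) := by
    rw [← ZMod.stdAddChar_coe]
    push_cast
    rw [ZMod.natCast_zmod_val]
  have hsplit : Complex.exp (2 * π * Complex.I * n * ((r.val : ℂ) + 1 / 2) / q) =
      Complex.exp (π * Complex.I * n / q) * ZMod.stdAddChar ((n : ZMod q) * r) := by
    rw [hψ, ← Complex.exp_add]
    congr 1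
    push_cast
    ring
  rw [hsplit, show (-(a : ZMod q)) * r ^ 2 + (-(a : ZMod q) + (n : ZMod q)) * r =
      ((-(a : ZMod q)) * r ^ 2 + (-(a : ZMod q)) * r) + n * r by ring,
    AddChar.map_add_eq_mul (ZMod.stdAddChar) ((-(a : ZMod q)) * r ^ 2 + (-(a : ZMod q)) * r)]
  ring

open Real in
lemma norm_one_div_cpow_half {u : ℂ} (hu : u ≠ 0) {q : ℕ} (hq : 0 < q) :
    ‖(1 / (u * q ^ 2 / π) ^ (1 / 2 : ℂ) : ℂ)‖ = √π / (q * √‖u‖) := by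
  have h : ((1 / 2 : ℝ) : ℂ) = (1 / 2 : ℂ) := by push_cast; rfl
  rw [← h, norm_div, norm_one, Complex.norm_cpow_real, norm_div, norm_mul, norm_pow,
    Complex.norm_natCast, Complex.norm_real, Real.norm_of_nonneg pi_pos.le, ← Real.sqrt_eq_rpow,
    Real.sqrt_div (by positivity), Real.sqrt_mul (by positivity), Real.sqrt_sq (by positivity)]
  field_simp

open Real in
lemma sqInvSum_div_le {u : ℂ} (hu : 0 < u.re) {q : ℕ} (hq : 0 < q) :
    sqInvSum / (π ^ 2 / (q ^ 2 * u)).re ≤ sqInvSum * (q ^ 2 * ‖u‖ ^ 2 / u.re) := by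
  have hu0 : u ≠ 0 := by rintro rfl; simp at hu
  rw [re_pi_sq_div, div_eq_mul_inv, inv_div]
  have h1 : (1 : ℝ) ≤ π ^ 2 := by nlinarith [pi_gt_three]
  refine mul_le_mul_of_nonneg_left ?_ sqInvSum_nonneg
  rw [div_le_div_iff₀ (by positivity) hu]
  have : 0 ≤ (q : ℝ) ^ 2 * ‖u‖ ^ 2 * u.re := by positivity
  nlinarith

open Real in
lemma norm_halfTheta_zero_add_rat_le {u : ℂ} (hu : 0 < u.re) {q : ℕ} (hq : 0 < q) {a : ℤ}
    (ha : IsCoprime a q) :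
    ‖halfTheta 0 (u + 2 * π * Complex.I * a / q)‖ ≤
      √(2 * π) * (1 + sqInvSum) / √(q * ‖u‖) * (1 + q ^ 2 * ‖u‖ ^ 2 / u.re) := by
  have : NeZero q := ⟨hq.ne'⟩
  have hu0 : u ≠ 0 := by rintro rfl; simp at hu
  have hunit : IsUnit (-(a : ZMod q)) := by
    have := ha.map (Int.castRingHom (ZMod q))
    simp only [eq_intCast, Int.cast_natCast, CharP.cast_eq_zero] at this
    exact (isCoprime_zero_right.mp this).neg
  rw [halfTheta_zero_add_rat hu q a, norm_mul, norm_mul, norm_one_div_cpow_half hu0 hq]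
  have h1 : ‖Complex.exp (-(π * Complex.I * a / (2 * q)))‖ = 1 := by
    rw [show -(π * Complex.I * a / (2 * q)) = ((-(π * a / (2 * q)) : ℝ) : ℂ) * Complex.I by
      push_cast; ring, Complex.norm_exp_ofReal_mul_I]
  have hG : ∀ c : ZMod q, ‖∑ r : ZMod q, ZMod.stdAddChar (-(a : ZMod q) * r ^ 2 + c * r)‖ ≤
      √(2 * q) := fun c =>
    Real.le_sqrt_of_sq_le (norm_sq_gaussSum_quadratic_le q _ (ZMod.isPrimitive_stdAddChar q) hunit c)
  set y := (π ^ 2 / (q ^ 2 * u) : ℂ).re with hy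
  have hypos : 0 < y := re_pi_sq_div_pos hu hq
  have hbound : ‖∑' n : ℤ, Complex.exp (-(π ^ 2 / (q ^ 2 * u)) * n ^ 2) *
        Complex.exp (π * Complex.I * n / q) *
        ∑ r : ZMod q, ZMod.stdAddChar (-(a : ZMod q) * r ^ 2 + (-(a : ZMod q) + (n : ZMod q)) * r)‖ ≤
      (∑' n : ℤ, Real.exp (-y * (n : ℝ) ^ 2)) * √(2 * q) := by
    refine tsum_of_norm_bounded ((summable_int_exp_neg_mul_sq hypos).hasSum.mul_right _) fun n => ?_
    rw [norm_mul, norm_mul, norm_exp_neg_mul_int_sq,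
      show π * Complex.I * n / q = ((π * n / q : ℝ) : ℂ) * Complex.I by push_cast; ring,
      Complex.norm_exp_ofReal_mul_I, mul_one]
    exact mul_le_mul_of_nonneg_left (hG _) (by positivity)
  have hS := sqInvSum_nonneg
  set X := (q : ℝ) ^ 2 * ‖u‖ ^ 2 / u.re with hX
  have hXpos : 0 ≤ X := by positivity
  have htsum : ∑' n : ℤ, Real.exp (-y * (n : ℝ) ^ 2) ≤ (1 + sqInvSum) * (1 + X) := by
    have h3 := tsum_int_exp_le hypos
    have h4 := sqInvSum_div_le hu hq
    rw [← hX] at h4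
    nlinarith
  rw [h1, one_mul]
  have hu' : 0 < ‖u‖ := norm_pos_iff.mpr hu0
  calc √π / (q * √‖u‖) * _ ≤ √π / (q * √‖u‖) * ((1 + sqInvSum) * (1 + X) * √(2 * q)) := by
        refine mul_le_mul_of_nonneg_left (hbound.trans ?_) (by positivity)
        gcongr
    _ = _ := by
        rw [Real.sqrt_mul (by norm_num) π, Real.sqrt_mul (by norm_num) (q : ℝ),
          Real.sqrt_mul (by positivity)]
        have hqq : (q : ℝ) = √q * √q := (Real.mul_self_sqrt (by positivity)).symm
        have hq' : 0 < √(q : ℝ) := Real.sqrt_pos.mpr (by exact_mod_cast hq)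
        have hu'' : 0 < √‖u‖ := Real.sqrt_pos.mpr hu'
        generalize hc : √(q : ℝ) = c at *
        rw [hqq]
        field_simp

/-- The leading behaviour of `halfTheta k` at the origin. -/
noncomputable def thetaMain (k : ℕ) (w : ℂ) : ℂ :=
  Complex.Gamma (k + 1 / 2) * w ^ (-((k : ℂ) + 1 / 2))

lemma hasDerivAt_thetaMain (k : ℕ) {w : ℂ} (hw : 0 < w.re) :
    HasDerivAt (thetaMain k) (-thetaMain (k + 1) w) w := by
  have h1 : HasDerivAt (fun z : ℂ => z ^ (-((k : ℂ) + 1 / 2)))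
      (-((k : ℂ) + 1 / 2) * w ^ (-((k : ℂ) + 1 / 2) - 1) * 1) w :=
    (hasDerivAt_id w).cpow_const (Or.inl hw)
  have hk : (k : ℂ) + 1 / 2 ≠ 0 := by
    intro h
    have := congrArg Complex.re h
    simp at this
    have hk : (0 : ℝ) ≤ k := Nat.cast_nonneg k
    linarith
  refine (h1.const_mul (Complex.Gamma (k + 1 / 2))).congr_deriv ?_
  rw [thetaMain, show ((k + 1 : ℕ) : ℂ) + 1 / 2 = ((k : ℂ) + 1 / 2) + 1 by push_cast; ring,
    Complex.Gamma_add_one _ hk,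
    show -((k : ℂ) + 1 / 2 + 1) = -((k : ℂ) + 1 / 2) - 1 by ring]
  ring

open Real in
lemma norm_halfTheta_sub_thetaMain_zero_le {u : ℂ} (hu : 0 < u.re) :
    ‖halfTheta 0 u - thetaMain 0 u‖ ≤ √π * sqInvSum / √‖u‖ * (‖u‖ ^ 2 / u.re) := by
  have hu0 : u ≠ 0 := by rintro rfl; simp at hu
  have hπ : (π : ℂ) ≠ 0 := by exact_mod_cast pi_pos.ne'
  have h := halfTheta_zero_add_rat hu 1 0
  have hψ : ∀ n : ℤ, ∑ r : ZMod 1, ZMod.stdAddChar (-((0 : ℤ) : ZMod 1) * r ^ 2 +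
      (-((0 : ℤ) : ZMod 1) + (n : ZMod 1)) * r) = (1 : ℂ) := by
    intro n
    have : ∀ x : ZMod 1, ZMod.stdAddChar x = (1 : ℂ) := fun x => by
      rw [Subsingleton.elim x 0, AddChar.map_zero_eq_one]
    simp [this]
  simp only [hψ] at h
  simp only [Int.cast_zero, mul_zero, zero_div, add_zero, neg_zero, Complex.exp_zero, one_mul,
    mul_one, Nat.cast_one, one_pow, div_one] at h
  have hmain : thetaMain 0 u = 1 / (u / π) ^ (1 / 2 : ℂ) := by
    have hup : u / π ≠ 0 := div_ne_zero hu0 hπ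
    rw [thetaMain, Nat.cast_zero, zero_add, Complex.Gamma_one_half_eq,
      one_div ((u / π) ^ (1 / 2 : ℂ)),
      ← Complex.cpow_neg]
    have : u = ((π : ℝ) : ℂ) * (u / π) := by field_simp
    conv_lhs => rw [this]
    rw [Complex.cpow_def_of_ne_zero (x := π * (u / π)) (mul_ne_zero hπ hup),
      Complex.log_ofReal_mul pi_pos hup, add_mul, Complex.exp_add,
      ← Complex.cpow_def_of_ne_zero hup, Complex.ofReal_log pi_pos.le,
      ← Complex.cpow_def_of_ne_zero hπ, ← mul_assoc, ← Complex.cpow_add _ _ hπ]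
    simp
  have hy := re_pi_sq_div_pos hu one_pos
  have hS := sqInvSum_div_le hu one_pos
  simp only [Nat.cast_one, one_pow, one_mul] at hy hS
  set y := (π ^ 2 / u : ℂ).re with hydef
  have hterm : ∀ n : ℤ, ‖Complex.exp (-(π ^ 2 / u) * n ^ 2) * Complex.exp (π * Complex.I * n)‖ =
      Real.exp (-y * (n : ℝ) ^ 2) := by
    intro n
    rw [norm_mul, norm_exp_neg_mul_int_sq,
      show π * Complex.I * n = ((π * n : ℝ) : ℂ) * Complex.I by push_cast; ring,
      Complex.norm_exp_ofReal_mul_I, mul_one]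
  have hsum : Summable fun n : ℤ =>
      Complex.exp (-(π ^ 2 / u) * n ^ 2) * Complex.exp (π * Complex.I * n) := by
    refine Summable.of_norm ?_
    simp_rw [hterm]
    exact summable_int_exp_neg_mul_sq hy
  rw [hsum.tsum_eq_add_tsum_ite 0] at h
  simp only [Int.cast_zero, ne_eq, OfNat.ofNat_ne_zero, not_false_eq_true, zero_pow, mul_zero,
    Complex.exp_zero, mul_one] at h
  rw [mul_add, mul_one, ← hmain] at h
  rw [h, add_sub_cancel_left, norm_mul, hmain]
  have hn := norm_one_div_cpow_half hu0 one_pos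
  simp only [Nat.cast_one, one_pow, mul_one, one_mul] at hn
  rw [hn, mul_comm √π sqInvSum, mul_div_assoc, mul_comm sqInvSum, mul_assoc]
  refine mul_le_mul_of_nonneg_left (le_trans ?_ hS) (by positivity)
  refine le_trans ?_ (tsum_int_exp_ne_zero_le hy)
  have hs2 : Summable fun n : ℤ => (if n = 0 then 0 else Real.exp (-y * (n : ℝ) ^ 2)) := by
    refine Summable.of_nonneg_of_le (fun n => ?_) (fun n => ?_) (summable_int_exp_neg_mul_sq hy)
    · split_ifs <;> positivity
    · split_ifs
      · positivity
      · exact le_rfl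
  refine tsum_of_norm_bounded hs2.hasSum fun n => ?_
  split_ifs
  · simp
  · exact (hterm n).le

lemma mem_closedBall_half_re {w z : ℂ} (hz : z ∈ Metric.closedBall w (w.re / 2)) :
    w.re / 2 ≤ z.re ∧ ‖w‖ / 2 ≤ ‖z‖ ∧ ‖z‖ ≤ 3 / 2 * ‖w‖ := by
  rw [mem_closedBall_iff_norm] at hz
  have h1 := Complex.abs_re_le_norm (z - w)
  have h2 := Complex.re_le_norm w
  have h3 := norm_sub_norm_le w z
  have h4 := norm_sub_norm_le z w
  rw [norm_sub_rev w z] at h3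
  rw [Complex.sub_re] at h1
  have h5 := abs_le.mp h1
  refine ⟨by linarith, by linarith, by linarith⟩

lemma closedBall_half_re_subset {w : ℂ} (hw : 0 < w.re) :
    Metric.closedBall w (w.re / 2) ⊆ {z : ℂ | 0 < z.re} := fun z hz => by
  have := (mem_closedBall_half_re hz).1
  simp only [Set.mem_ofPred_eq]
  linarith

lemma isOpen_re_pos : IsOpen {z : ℂ | 0 < z.re} := isOpen_lt continuous_const Complex.continuous_re

lemma exists_norm_halfTheta_rat_le (k : ℕ) {B : ℝ} (hB : 0 ≤ B) :
    ∃ C : ℝ, 0 ≤ C ∧ ∀ (w : ℂ) (q : ℕ) (a : ℤ), 0 < w.re → 0 < q → IsCoprime a q →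
      q ^ 2 * ‖w‖ ^ 2 ≤ B * w.re →
      ‖halfTheta k (w + 2 * Real.pi * Complex.I * a / q)‖ ≤ C / w.re ^ k / √(q * ‖w‖) := by
  set K := √(2 * Real.pi) * (1 + sqInvSum) with hK
  have hK0 : 0 ≤ K := mul_nonneg (Real.sqrt_nonneg _) (by linarith [sqInvSum_nonneg])
  refine ⟨k.factorial * (K * √2 * (1 + 5 * B)) * 2 ^ k, by positivity, ?_⟩
  intro w q a hw hq ha hwB
  set f : ℕ → ℂ → ℂ := fun k z => halfTheta k (z + 2 * Real.pi * Complex.I * a / q) with hf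
  have hre : ∀ z : ℂ, (z + 2 * Real.pi * Complex.I * a / q).re = z.re := by
    intro z
    have : 2 * Real.pi * Complex.I * a / q = ((2 * Real.pi * a / q : ℝ) : ℂ) * Complex.I := by
      push_cast; ring
    rw [this, Complex.add_re, Complex.re_ofReal_mul, Complex.I_re, mul_zero, add_zero]
  have hder : ∀ k, ∀ z ∈ {z : ℂ | 0 < z.re}, HasDerivAt (f k) (-f (k + 1) z) z := by
    intro k z hz
    exact (hasDerivAt_halfTheta k (by rw [hre]; exact hz)).comp_add_const z _
  have hwn : 0 < ‖w‖ := norm_pos_iff.mpr (by rintro rfl; simp at hw)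
  have hq' : (0 : ℝ) < q := by exact_mod_cast hq
  have hbd : ∀ z ∈ Metric.closedBall w (w.re / 2),
      ‖f 0 z‖ ≤ K * √2 * (1 + 5 * B) / √(q * ‖w‖) := by
    intro z hz
    obtain ⟨h1, h2, h3⟩ := mem_closedBall_half_re hz
    have hz0 : 0 < z.re := closedBall_half_re_subset hw hz
    refine (norm_halfTheta_zero_add_rat_le hz0 hq ha).trans ?_
    rw [← hK, div_eq_mul_inv K]
    have hzn : 0 < ‖z‖ := by linarith
    have e1 : (√(q * ‖z‖))⁻¹ ≤ √2 * (√(q * ‖w‖))⁻¹ := by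
      rw [← div_eq_mul_inv, ← Real.sqrt_div (by norm_num), ← Real.sqrt_inv]
      refine Real.sqrt_le_sqrt ?_
      rw [inv_eq_one_div, div_le_div_iff₀ (by positivity) (by positivity)]
      nlinarith
    have e2 : 1 + q ^ 2 * ‖z‖ ^ 2 / z.re ≤ 1 + 5 * B := by
      have : q ^ 2 * ‖z‖ ^ 2 / z.re ≤ 5 * B := by
        rw [div_le_iff₀ hz0]
        have : ‖z‖ ^ 2 ≤ (3 / 2 * ‖w‖) ^ 2 := by gcongr
        have h4 : (q : ℝ) ^ 2 * ‖z‖ ^ 2 ≤ q ^ 2 * (3 / 2 * ‖w‖) ^ 2 := by gcongr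
        nlinarith
      linarith
    calc K * (√(q * ‖z‖))⁻¹ * (1 + q ^ 2 * ‖z‖ ^ 2 / z.re)
        ≤ K * (√2 * (√(q * ‖w‖))⁻¹) * (1 + 5 * B) := by gcongr
      _ = _ := by ring
  have := norm_le_of_hasDerivAt_neg isOpen_re_pos hder (half_pos hw)
    (closedBall_half_re_subset hw) hbd k
  refine this.trans (le_of_eq ?_)
  rw [div_pow]
  field_simp

lemma exists_norm_halfTheta_sub_thetaMain_le (k : ℕ) :
    ∃ C : ℝ, 0 ≤ C ∧ ∀ w : ℂ, 0 < w.re →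
      ‖halfTheta k w - thetaMain k w‖ ≤ C / w.re ^ k / √‖w‖ * (‖w‖ ^ 2 / w.re) := by
  set K := √Real.pi * sqInvSum with hK
  have hK0 : 0 ≤ K := mul_nonneg (Real.sqrt_nonneg _) sqInvSum_nonneg
  refine ⟨k.factorial * (K * √2 * 5) * 2 ^ k, by positivity, ?_⟩
  intro w hw
  have hder : ∀ k, ∀ z ∈ {z : ℂ | 0 < z.re}, HasDerivAt (fun z => halfTheta k z - thetaMain k z)
      (-(halfTheta (k + 1) z - thetaMain (k + 1) z)) z := by
    intro k z hz
    exact ((hasDerivAt_halfTheta k hz).sub (hasDerivAt_thetaMain k hz)).congr_deriv (by ring)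
  have hwn : 0 < ‖w‖ := norm_pos_iff.mpr (by rintro rfl; simp at hw)
  have hbd : ∀ z ∈ Metric.closedBall w (w.re / 2),
      ‖halfTheta 0 z - thetaMain 0 z‖ ≤ K * √2 * 5 / √‖w‖ * (‖w‖ ^ 2 / w.re) := by
    intro z hz
    obtain ⟨h1, h2, h3⟩ := mem_closedBall_half_re hz
    have hz0 : 0 < z.re := closedBall_half_re_subset hw hz
    refine (norm_halfTheta_sub_thetaMain_zero_le hz0).trans ?_
    have e1 : (√‖z‖)⁻¹ ≤ √2 * (√‖w‖)⁻¹ := by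
      rw [← div_eq_mul_inv, ← Real.sqrt_div (by norm_num), ← Real.sqrt_inv]
      refine Real.sqrt_le_sqrt ?_
      rw [inv_eq_one_div, div_le_div_iff₀ (by linarith) (by positivity)]
      linarith
    have e2 : ‖z‖ ^ 2 / z.re ≤ 5 * (‖w‖ ^ 2 / w.re) := by
      rw [← mul_div_assoc, div_le_div_iff₀ hz0 hw]
      have : ‖z‖ ^ 2 ≤ (3 / 2 * ‖w‖) ^ 2 := by gcongr
      have h4 : ‖z‖ ^ 2 * w.re ≤ (3 / 2 * ‖w‖) ^ 2 * (2 * z.re) := by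
        gcongr
        linarith
      nlinarith [mul_pos (pow_pos hwn 2) hz0]
    rw [← hK, div_eq_mul_inv]
    calc K * (√‖z‖)⁻¹ * (‖z‖ ^ 2 / z.re)
        ≤ K * (√2 * (√‖w‖)⁻¹) * (5 * (‖w‖ ^ 2 / w.re)) := by gcongr
      _ = _ := by ring
  have := norm_le_of_hasDerivAt_neg (f := fun k z => halfTheta k z - thetaMain k z)
    isOpen_re_pos hder (half_pos hw) (closedBall_half_re_subset hw) hbd k
  refine this.trans (le_of_eq ?_)
  rw [div_pow]
  field_simp

lemma norm_thetaMain_le (k : ℕ) {w : ℂ} (hw : 0 < w.re) :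
    ‖thetaMain k w‖ ≤ ‖Complex.Gamma (k + 1 / 2)‖ / w.re ^ k / √‖w‖ := by
  have hwn : 0 < ‖w‖ := norm_pos_iff.mpr (by rintro rfl; simp at hw)
  have h : (-((k : ℂ) + 1 / 2)) = ((-((k : ℝ) + 1 / 2) : ℝ) : ℂ) := by push_cast; rfl
  rw [thetaMain, norm_mul, h, Complex.norm_cpow_real, Real.rpow_neg hwn.le,
    Real.rpow_add hwn, Real.rpow_natCast, ← Real.sqrt_eq_rpow, div_div, ← div_eq_mul_inv]
  have := Complex.re_le_norm w
  gcongr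

lemma norm_prod_sub_prod_le {ι : Type*} (s : Finset ι) {x y : ι → ℂ} {A : ι → ℝ} {η : ℝ}
    (hx : ∀ i, ‖x i‖ ≤ A i) (hy : ∀ i, ‖y i‖ ≤ A i) (hxy : ∀ i, ‖x i - y i‖ ≤ A i * η) :
    ‖∏ i ∈ s, x i - ∏ i ∈ s, y i‖ ≤ s.card * (∏ i ∈ s, A i) * η := by
  classical
  have hA : ∀ i, 0 ≤ A i := fun i => (norm_nonneg _).trans (hx i)
  induction s using Finset.induction_on with
  | empty => simp
  | insert j s hj ih =>
    rw [Finset.prod_insert hj, Finset.prod_insert hj, Finset.prod_insert hj,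
      Finset.card_insert_of_notMem hj]
    have h1 : x j * ∏ i ∈ s, x i - y j * ∏ i ∈ s, y i =
        x j * (∏ i ∈ s, x i - ∏ i ∈ s, y i) + (x j - y j) * ∏ i ∈ s, y i := by ring
    have h2 : ‖∏ i ∈ s, y i‖ ≤ ∏ i ∈ s, A i := by
      rw [norm_prod]
      exact Finset.prod_le_prod (fun i _ => norm_nonneg _) fun i _ => hy i
    have h0 : 0 ≤ A j * η := (norm_nonneg _).trans (hxy j)
    rw [h1]
    refine (norm_add_le _ _).trans ?_
    rw [norm_mul, norm_mul]
    calc _ ≤ A j * (s.card * (∏ i ∈ s, A i) * η) + A j * η * ∏ i ∈ s, A i := by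
          gcongr
          · exact hA j
          · exact hx j
          · exact hxy j
      _ = _ := by push_cast; ring

lemma cpow_finsetSum {ι : Type*} {w : ℂ} (hw : w ≠ 0) (s : Finset ι) (f : ι → ℂ) :
    ∏ i ∈ s, w ^ f i = w ^ ∑ i ∈ s, f i := by
  classical
  induction s using Finset.induction_on with
  | empty => simp
  | insert j s hj ih =>
    rw [Finset.prod_insert hj, Finset.sum_insert hj, Complex.cpow_add _ _ hw, ih]

section Products

variable {ι : Type*} [Fintype ι] (k : ι → ℕ)

lemma prod_div_pow_div (C : ι → ℝ) (x y : ℝ) :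
    ∏ i, (C i / x ^ k i / y) = (∏ i, C i) / x ^ (∑ i, k i) / y ^ Fintype.card ι := by
  rw [Finset.prod_div_distrib, Finset.prod_div_distrib, Finset.prod_pow_eq_pow_sum,
    Finset.prod_const, Finset.card_univ]

lemma exists_norm_prod_halfTheta_rat_le {B : ℝ} (hB : 0 ≤ B) :
    ∃ C : ℝ, 0 ≤ C ∧ ∀ (w : ℂ) (q : ℕ) (a : ℤ), 0 < w.re → 0 < q → IsCoprime a q →
      q ^ 2 * ‖w‖ ^ 2 ≤ B * w.re →
      ‖∏ i, halfTheta (k i) (w + 2 * Real.pi * Complex.I * a / q)‖ ≤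
        C / w.re ^ (∑ i, k i) / √(q * ‖w‖) ^ Fintype.card ι := by
  choose C hC0 hC using fun i => exists_norm_halfTheta_rat_le (k i) hB
  refine ⟨∏ i, C i, Finset.prod_nonneg fun i _ => hC0 i, fun w q a hw hq ha h => ?_⟩
  rw [norm_prod, ← prod_div_pow_div]
  exact Finset.prod_le_prod (fun i _ => norm_nonneg _) fun i _ => hC i w q a hw hq ha h

lemma exists_norm_prod_halfTheta_sub_le {B : ℝ} (hB : 0 ≤ B) :
    ∃ C : ℝ, 0 ≤ C ∧ ∀ w : ℂ, 0 < w.re → ‖w‖ ^ 2 ≤ B * w.re →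
      ‖∏ i, halfTheta (k i) w - ∏ i, thetaMain (k i) w‖ ≤
        C / w.re ^ (∑ i, k i) / √‖w‖ ^ Fintype.card ι * (‖w‖ ^ 2 / w.re) := by
  choose C hC0 hC using fun i => exists_norm_halfTheta_rat_le (k i) hB
  choose D hD0 hD using fun i => exists_norm_halfTheta_sub_thetaMain_le (k i)
  set A : ι → ℝ := fun i => C i + D i + ‖Complex.Gamma (k i + 1 / 2)‖ with hA
  refine ⟨Fintype.card ι * ∏ i, A i, mul_nonneg (by positivity)
    (Finset.prod_nonneg fun i _ => add_nonneg (add_nonneg (hC0 i) (hD0 i)) (norm_nonneg _)), ?_⟩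
  intro w hw hwB
  have h := norm_prod_sub_prod_le (Finset.univ : Finset ι) (x := fun i => halfTheta (k i) w)
    (y := fun i => thetaMain (k i) w) (A := fun i => A i / w.re ^ k i / √‖w‖)
    (η := ‖w‖ ^ 2 / w.re) (fun i => ?_) (fun i => ?_) (fun i => ?_)
  · rw [prod_div_pow_div, Finset.card_univ] at h
    refine h.trans (le_of_eq ?_)
    ring
  · have := hC i w 1 0 hw one_pos (by rw [Nat.cast_one]; exact isCoprime_one_right) (by simpa using hwB)
    simp only [Int.cast_zero, mul_zero, zero_div, add_zero, Nat.cast_one, one_mul] at this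
    refine this.trans ?_
    gcongr
    linarith [hD0 i, norm_nonneg (Complex.Gamma (k i + 1 / 2))]
  · refine (norm_thetaMain_le (k i) hw).trans ?_
    gcongr
    linarith [hD0 i, hC0 i]
  · refine (hD i w hw).trans ?_
    gcongr
    linarith [hC0 i, norm_nonneg (Complex.Gamma (k i + 1 / 2))]

lemma prod_thetaMain {w : ℂ} (hw : 0 < w.re) :
    ∏ i, thetaMain (k i) w = ((∏ i, Real.Gamma (k i + 1 / 2) : ℝ) : ℂ) *
      w ^ (-(((∑ i, k i : ℕ) + Fintype.card ι / 2 : ℝ) : ℂ)) := by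
  have hw0 : w ≠ 0 := by rintro rfl; simp at hw
  simp only [thetaMain]
  rw [Finset.prod_mul_distrib]
  congr 1
  · rw [Complex.ofReal_prod]
    refine Finset.prod_congr rfl fun i _ => ?_
    rw [← Complex.Gamma_ofReal]
    push_cast
    rfl
  · rw [cpow_finsetSum hw0]
    congr 1
    push_cast
    rw [Finset.sum_neg_distrib, Finset.sum_add_distrib, Finset.sum_const, Finset.card_univ,
      nsmul_eq_mul]
    ring

end Products

/-- The point `δ + 2πiα` of the vertical line `re w = δ`. -/
noncomputable def linePt (δ α : ℝ) : ℂ := δ + 2 * Real.pi * α * Complex.I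

lemma linePt_eq (δ α : ℝ) : linePt δ α = ⟨δ, 2 * Real.pi * α⟩ := by
  rw [linePt, Complex.mk_eq_add_mul_I]; push_cast; rfl

@[simp] lemma linePt_re (δ α : ℝ) : (linePt δ α).re = δ := by rw [linePt_eq]

@[simp] lemma linePt_im (δ α : ℝ) : (linePt δ α).im = 2 * Real.pi * α := by rw [linePt_eq]

lemma norm_linePt_sq (δ α : ℝ) : ‖linePt δ α‖ ^ 2 = δ ^ 2 + 4 * Real.pi ^ 2 * α ^ 2 := by
  rw [← Complex.normSq_eq_norm_sq, Complex.normSq_apply, linePt_re, linePt_im]; ring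

lemma le_norm_linePt {δ : ℝ} (α : ℝ) : δ ≤ ‖linePt δ α‖ := by
  simpa using Complex.re_le_norm (linePt δ α)

lemma abs_le_norm_linePt (δ α : ℝ) : 2 * Real.pi * |α| ≤ ‖linePt δ α‖ := by
  have := Complex.abs_im_le_norm (linePt δ α)
  rwa [linePt_im, abs_mul, abs_of_pos Real.two_pi_pos] at this

lemma norm_linePt_pos {δ : ℝ} (hδ : 0 < δ) (α : ℝ) : 0 < ‖linePt δ α‖ :=
  hδ.trans_le (le_norm_linePt α)

@[fun_prop] lemma continuous_linePt (δ : ℝ) : Continuous (linePt δ) := by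
  unfold linePt; fun_prop

lemma linePt_scale {δ : ℝ} (hδ : 0 < δ) (α : ℝ) : ‖linePt δ α‖ = δ * ‖linePt 1 (α / δ)‖ := by
  have : linePt δ α = (δ : ℂ) * linePt 1 (α / δ) := by
    have : (δ : ℂ) ≠ 0 := by exact_mod_cast hδ.ne'
    simp only [linePt]; push_cast; field_simp
  rw [this, norm_mul, Complex.norm_real, Real.norm_eq_abs, abs_of_pos hδ]

lemma integrable_norm_linePt_one {s : ℝ} (hs : 1 < s) :
    Integrable fun α : ℝ => ‖linePt 1 α‖ ^ (-s) := by
  have h := integrable_rpow_neg_one_add_norm_sq (E := ℝ) (μ := volume) (r := s) (by simpa using hs)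
  refine h.mono' (Continuous.aestronglyMeasurable ?_) (ae_of_all _ fun α => ?_)
  · exact (continuous_linePt 1).norm.rpow_const
      fun α => Or.inl (norm_linePt_pos one_pos α).ne'
  · have h1 : (1 + ‖α‖ ^ 2) ≤ ‖linePt 1 α‖ ^ 2 := by
      rw [norm_linePt_sq, Real.norm_eq_abs, sq_abs]
      have : 1 ≤ 4 * Real.pi ^ 2 := by nlinarith [Real.pi_gt_three]
      nlinarith [sq_nonneg α]
    rw [Real.norm_of_nonneg (by positivity)]
    have h2 : ‖linePt 1 α‖ ^ (-s) = (‖linePt 1 α‖ ^ 2) ^ (-s / 2) := by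
      rw [← Real.rpow_natCast, ← Real.rpow_mul (norm_nonneg _)]
      congr 1; push_cast; ring
    rw [h2]
    exact Real.rpow_le_rpow_of_nonpos (by positivity) h1 (by linarith)

/-- The integral `∫ |1 + 2πit| ^ (-s) dt`. -/
noncomputable def lineConst (s : ℝ) : ℝ := ∫ α : ℝ, ‖linePt 1 α‖ ^ (-s)

lemma lineConst_nonneg (s : ℝ) : 0 ≤ lineConst s := integral_nonneg fun α => by positivity

lemma integrable_norm_linePt {s δ : ℝ} (hs : 1 < s) (hδ : 0 < δ) (β : ℝ) :
    Integrable fun α : ℝ => ‖linePt δ (α - β)‖ ^ (-s) := by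
  have h := (((integrable_norm_linePt_one hs).comp_div hδ.ne').const_mul (δ ^ (-s))).comp_sub_right β
  refine h.congr (ae_of_all _ fun α => ?_)
  simp only
  rw [linePt_scale hδ, Real.mul_rpow hδ.le (norm_nonneg _)]

lemma integral_norm_linePt {s δ : ℝ} (hδ : 0 < δ) (β : ℝ) :
    ∫ α : ℝ, ‖linePt δ (α - β)‖ ^ (-s) = lineConst s * δ ^ (1 - s) := by
  rw [integral_sub_right_eq_self (fun α => ‖linePt δ α‖ ^ (-s))]
  have : ∀ α, ‖linePt δ α‖ ^ (-s) = δ ^ (-s) * ‖linePt 1 (α / δ)‖ ^ (-s) := fun α => by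
    rw [linePt_scale hδ, Real.mul_rpow hδ.le (norm_nonneg _)]
  simp_rw [this]
  rw [integral_const_mul, Measure.integral_comp_div (fun α => ‖linePt 1 α‖ ^ (-s)),
    abs_of_pos hδ, smul_eq_mul, lineConst, sub_eq_add_neg, Real.rpow_add hδ, Real.rpow_one]
  ring

lemma integrable_rpow_mul_exp {s ε : ℝ} (hs : 0 < s) (hε : 0 < ε) :
    IntegrableOn (fun t : ℝ => t ^ (s - 1) * Real.exp (-(ε * t))) (Set.Ioi 0) := by
  have h := integrableOn_rpow_mul_exp_neg_mul_rpow (p := 1) (s := s - 1) (b := ε) (by linarith)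
    one_pos hε
  simpa [neg_mul] using h

lemma norm_laplace_term {s t : ℝ} (ht : 0 < t) (w : ℂ) :
    ‖((t ^ (s - 1) : ℝ) : ℂ) * Complex.exp (-(w * t))‖ =
      t ^ (s - 1) * Real.exp (-(w.re * t)) := by
  rw [norm_mul, Complex.norm_exp, Complex.norm_real, Real.norm_of_nonneg (by positivity),
    Complex.neg_re, Complex.re_mul_ofReal]

lemma continuousOn_laplace_term (s : ℝ) (w : ℂ) :
    ContinuousOn (fun t : ℝ => ((t ^ (s - 1) : ℝ) : ℂ) * Complex.exp (-(w * t))) (Set.Ioi 0) := by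
  refine ContinuousOn.mul ?_ (by fun_prop)
  exact Complex.continuous_ofReal.comp_continuousOn
    (continuousOn_id.rpow_const fun t ht => Or.inl (ne_of_gt ht))

lemma integrable_laplace {s : ℝ} (hs : 0 < s) {w : ℂ} (hw : 0 < w.re) :
    IntegrableOn (fun t : ℝ => ((t ^ (s - 1) : ℝ) : ℂ) * Complex.exp (-(w * t))) (Set.Ioi 0) := by
  refine (integrable_rpow_mul_exp hs hw).mono'
    ((continuousOn_laplace_term s w).aestronglyMeasurable measurableSet_Ioi) ?_
  filter_upwards [self_mem_ae_restrict measurableSet_Ioi] with t ht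
  exact (norm_laplace_term ht w).le

lemma hasDerivAt_laplace {s : ℝ} (hs : 0 < s) {w : ℂ} (hw : 0 < w.re) :
    DifferentiableAt ℂ
      (fun w : ℂ => ∫ t in Set.Ioi (0 : ℝ), ((t ^ (s - 1) : ℝ) : ℂ) * Complex.exp (-(w * t))) w := by
  have hnhds : {z : ℂ | w.re / 2 < z.re} ∈ nhds w :=
    (isOpen_lt continuous_const Complex.continuous_re).mem_nhds (by simp; linarith)
  refine (hasDerivAt_integral_of_dominated_loc_of_deriv_le
    (F' := fun w t => ((t ^ (s - 1) : ℝ) : ℂ) * (Complex.exp (-(w * t)) * (-t)))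
    (bound := fun t => t ^ (s + 1 - 1) * Real.exp (-(w.re / 2 * t))) hnhds ?_ ?_ ?_ ?_ ?_ ?_).2.differentiableAt
  · exact Eventually.of_forall fun z =>
      (continuousOn_laplace_term s z).aestronglyMeasurable measurableSet_Ioi
  · exact integrable_laplace hs hw
  · refine ContinuousOn.aestronglyMeasurable ?_ measurableSet_Ioi
    simp_rw [← mul_assoc]
    exact (continuousOn_laplace_term s w).mul (by fun_prop)
  · filter_upwards [self_mem_ae_restrict measurableSet_Ioi] with t ht z hz
    have ht : 0 < t := ht
    have hz : w.re / 2 < z.re := hz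
    rw [← mul_assoc, norm_mul, norm_laplace_term ht, norm_neg, Complex.norm_real,
      Real.norm_of_nonneg ht.le, add_sub_right_comm, Real.rpow_add ht, Real.rpow_one, mul_right_comm]
    gcongr
  · exact integrable_rpow_mul_exp (by linarith) (by linarith)
  · refine Eventually.of_forall fun t z _ => ?_
    have h1 : HasDerivAt (fun z : ℂ => -(z * t)) (-(t : ℂ)) z := by
      have h := ((hasDerivAt_id z).mul_const (t : ℂ)).neg
      rw [one_mul] at h
      exact h
    exact h1.cexp.const_mul _

/-- The Laplace transform of `t ^ (s - 1)` on the right half plane. -/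
lemma integral_rpow_mul_cexp {s : ℝ} (hs : 0 < s) {w : ℂ} (hw : 0 < w.re) :
    ∫ t in Set.Ioi (0 : ℝ), ((t ^ (s - 1) : ℝ) : ℂ) * Complex.exp (-(w * t)) =
      Real.Gamma s * w ^ (-(s : ℂ)) := by
  have h1 : AnalyticOnNhd ℂ (fun w : ℂ => ∫ t in Set.Ioi (0 : ℝ),
      ((t ^ (s - 1) : ℝ) : ℂ) * Complex.exp (-(w * t))) {z : ℂ | 0 < z.re} :=
    DifferentiableOn.analyticOnNhd
      (fun z hz => (hasDerivAt_laplace hs hz).differentiableWithinAt) isOpen_re_pos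
  have h2 : AnalyticOnNhd ℂ (fun w : ℂ => Real.Gamma s * w ^ (-(s : ℂ))) {z : ℂ | 0 < z.re} := by
    refine DifferentiableOn.analyticOnNhd (fun z hz => ?_) isOpen_re_pos
    refine DifferentiableAt.differentiableWithinAt ?_
    refine DifferentiableAt.const_mul ?_ _
    exact differentiableAt_id.cpow (differentiableAt_const _) (Or.inl hz)
  have hconv : Convex ℝ {z : ℂ | 0 < z.re} := convex_halfSpace_re_gt 0
  refine h1.eqOn_of_preconnected_of_frequently_eq h2 hconv.isPreconnected
    (z₀ := 1) (by simp) ?_ hw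
  have key : ∀ r : ℝ, 0 < r → ∫ t in Set.Ioi (0 : ℝ),
      ((t ^ (s - 1) : ℝ) : ℂ) * Complex.exp (-((r : ℂ) * t)) =
      Real.Gamma s * (r : ℂ) ^ (-(s : ℂ)) := by
    intro r hr
    have h := Real.integral_rpow_mul_exp_neg_mul_Ioi hs hr
    have : ∀ t : ℝ, ((t ^ (s - 1) : ℝ) : ℂ) * Complex.exp (-((r : ℂ) * t)) =
        ((t ^ (s - 1) * Real.exp (-(r * t)) : ℝ) : ℂ) := fun t => by push_cast; rfl
    simp_rw [this]
    rw [integral_complex_ofReal, h, one_div, Real.inv_rpow hr.le, ← Real.rpow_neg hr.le, mul_comm]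
    push_cast
    rw [Complex.ofReal_cpow hr.le]
    push_cast
    rfl
  have htend : Tendsto (fun m : ℕ => (((1 : ℝ) + 1 / (m + 1 : ℝ) : ℝ) : ℂ)) atTop
      (nhdsWithin 1 {1}ᶜ) := by
    refine tendsto_nhdsWithin_iff.mpr ⟨?_, Eventually.of_forall fun m => ?_⟩
    · have := (tendsto_one_div_add_atTop_nhds_zero_nat (𝕜 := ℝ)).const_add 1
      rw [add_zero] at this
      have h := (Complex.continuous_ofReal.tendsto 1).comp this
      rwa [Complex.ofReal_one] at h
    · simp only [Set.mem_compl_iff, Set.mem_singleton_iff]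
      intro h
      have h' : (1 : ℝ) + 1 / (m + 1 : ℝ) = 1 := by exact_mod_cast h
      have : (0 : ℝ) < 1 / (m + 1 : ℝ) := by positivity
      linarith
  refine htend.frequently (Eventually.of_forall fun m => ?_).frequently
  exact key _ (by positivity)

/-- The inverse Laplace transform of `w ^ (-s)`. -/
lemma integral_linePt_cpow_mul_exp {s δ y : ℝ} (hs : 1 < s) (hδ : 0 < δ) (hy : 0 < y) :
    ∫ α : ℝ, linePt δ α ^ (-(s : ℂ)) * Complex.exp (y * linePt δ α) =
      ((y ^ (s - 1) / Real.Gamma s : ℝ) : ℂ) := by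
  have hs0 : 0 < s := by linarith
  have hG : (0 : ℝ) < Real.Gamma s := Real.Gamma_pos_of_pos hs0
  have hGc : (Real.Gamma s : ℂ) ≠ 0 := by exact_mod_cast hG.ne'
  set f : ℝ → ℂ := (Set.Ioi (0 : ℝ)).indicator
    fun t => ((t ^ (s - 1) : ℝ) : ℂ) * Complex.exp (-((δ : ℂ) * t)) with hf
  have hfi : Integrable f :=
    (integrable_laplace hs0 (w := (δ : ℂ)) (by simpa using hδ)).integrable_indicator measurableSet_Ioi
  have hF : ∀ α, FourierTransform.fourier f α = Real.Gamma s * linePt δ α ^ (-(s : ℂ)) := by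
    intro α
    rw [← integral_rpow_mul_cexp hs0 (by simpa using hδ), Real.fourier_real_eq_integral_exp_smul,
      ← integral_indicator measurableSet_Ioi]
    refine integral_congr_ae (ae_of_all _ fun t => ?_)
    by_cases ht : t ∈ Set.Ioi (0 : ℝ)
    · simp only [hf, Set.indicator_of_mem ht, smul_eq_mul]
      rw [mul_left_comm, ← Complex.exp_add]
      congr 2
      rw [linePt]; push_cast; ring
    · simp only [hf, Set.indicator_of_notMem ht, smul_zero]
  have hnorm : ∀ α, ‖linePt δ α ^ (-(s : ℂ))‖ = ‖linePt δ (α - 0)‖ ^ (-s) := fun α => by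
    rw [← Complex.ofReal_neg, Complex.norm_cpow_real, sub_zero]
  have hcont : Continuous fun α => linePt δ α ^ (-(s : ℂ)) := by
    refine Continuous.cpow (continuous_linePt δ) continuous_const fun α => Or.inl ?_
    simpa using hδ
  have hi : Integrable fun α => linePt δ α ^ (-(s : ℂ)) := by
    refine (integrable_norm_linePt hs hδ 0).mono' hcont.aestronglyMeasurable (ae_of_all _ fun α => ?_)
    exact (hnorm α).le
  have hFi : Integrable (FourierTransform.fourier f) := by
    rw [funext hF]
    exact hi.const_mul _
  have hcts : ContinuousAt f y := by
    have h1 : ContinuousAt (fun t : ℝ => ((t ^ (s - 1) : ℝ) : ℂ) * Complex.exp (-((δ : ℂ) * t))) y :=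
      (continuousOn_laplace_term s δ).continuousAt (Ioi_mem_nhds hy)
    refine h1.congr ?_
    filter_upwards [Ioi_mem_nhds hy] with t ht
    exact (Set.indicator_of_mem (show t ∈ Set.Ioi (0 : ℝ) from ht)
      (fun t : ℝ => ((t ^ (s - 1) : ℝ) : ℂ) * Complex.exp (-((δ : ℂ) * t)))).symm
  have hinv := hfi.fourierInv_fourier_eq hFi hcts
  rw [Real.fourierInv_eq'] at hinv
  simp only [hF] at hinv
  have hfy : f y = ((y ^ (s - 1) : ℝ) : ℂ) * Complex.exp (-((δ : ℂ) * y)) :=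
    Set.indicator_of_mem (show y ∈ Set.Ioi (0 : ℝ) from hy) _
  rw [hfy] at hinv
  have e : ∀ α : ℝ, linePt δ α ^ (-(s : ℂ)) * Complex.exp (y * linePt δ α) =
      (Complex.exp (δ * y) / Real.Gamma s) *
        (Complex.exp (((2 * Real.pi * inner ℝ α y : ℝ) : ℂ) * Complex.I) •
          (Real.Gamma s * linePt δ α ^ (-(s : ℂ)))) := by
    intro α
    have h1 : Complex.exp (y * linePt δ α) =
        Complex.exp (δ * y) * Complex.exp (((2 * Real.pi * inner ℝ α y : ℝ) : ℂ) * Complex.I) := by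
      rw [← Complex.exp_add, linePt]
      congr 1
      simp only [RCLike.inner_apply, conj_trivial]
      push_cast; ring
    rw [h1, smul_eq_mul]
    field_simp
  simp_rw [e]
  rw [integral_const_mul, hinv, Complex.exp_neg]
  have := Complex.exp_ne_zero ((δ : ℂ) * y)
  push_cast
  field_simp

/-- The kernel extracting from `∑ W exp (-w (Q + c))` the coefficients with `Q ≤ N`. -/
noncomputable def geoKernel (c : ℝ) (N : ℕ) (w : ℂ) : ℂ :=
  ∑ j ∈ Finset.range (N + 1), Complex.exp (((j : ℝ) + c : ℝ) * w)

@[fun_prop] lemma continuous_geoKernel (c : ℝ) (N : ℕ) : Continuous (geoKernel c N) := by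
  unfold geoKernel; fun_prop

lemma norm_geoKernel_le {c : ℝ} (hc : 0 ≤ c) {N : ℕ} (hN : 0 < N) (α : ℝ) :
    ‖geoKernel c N (linePt (1 / N) α)‖ ≤ 2 * Real.exp (c + 1) * N := by
  have hN' : (1 : ℝ) ≤ N := by exact_mod_cast hN
  have h : ∀ j ∈ Finset.range (N + 1),
      ‖Complex.exp (((j : ℝ) + c : ℝ) * linePt (1 / N) α)‖ ≤ Real.exp (c + 1) := by
    intro j hj
    have hj' : (j : ℝ) ≤ N := by exact_mod_cast Nat.lt_succ_iff.mp (Finset.mem_range.mp hj)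
    rw [Complex.norm_exp, Complex.re_ofReal_mul, linePt_re, mul_one_div]
    refine Real.exp_le_exp.mpr ?_
    rw [div_le_iff₀ (by positivity)]
    nlinarith
  refine (norm_sum_le _ _).trans ((Finset.sum_le_sum h).trans ?_)
  rw [Finset.sum_const, Finset.card_range, nsmul_eq_mul]
  push_cast
  nlinarith [Real.exp_pos (c + 1)]

lemma four_mul_abs_le_norm_exp_sub_one {δ α : ℝ} (hδ : 0 ≤ δ) (hα : |α| ≤ 1 / 2) :
    4 * |α| ≤ ‖Complex.exp (linePt δ α) - 1‖ := by
  have h1 : Complex.exp (linePt δ α) = ⟨Real.exp δ * Real.cos (2 * Real.pi * α),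
      Real.exp δ * Real.sin (2 * Real.pi * α)⟩ := by
    apply Complex.ext
    · rw [Complex.exp_re, linePt_re, linePt_im]
    · rw [Complex.exp_im, linePt_re, linePt_im]
  have hr : 1 ≤ Real.exp δ := Real.one_le_exp hδ
  have hcos := Real.cos_le_one_sub_mul_cos_sq (x := 2 * Real.pi * α) (by
    rw [abs_mul, abs_of_pos Real.two_pi_pos]; nlinarith [Real.pi_pos])
  refine le_of_sq_le_sq ?_ (norm_nonneg _)
  rw [← Complex.normSq_eq_norm_sq, Complex.normSq_apply, h1]
  simp only [Complex.sub_re, Complex.one_re, Complex.sub_im, Complex.one_im]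
  have hcos' : 8 * α ^ 2 ≤ 1 - Real.cos (2 * Real.pi * α) := by
    have : 2 / Real.pi ^ 2 * (2 * Real.pi * α) ^ 2 = 8 * α ^ 2 := by
      have := Real.pi_pos
      field_simp; ring
    linarith
  have hp : (4 * |α|) ^ 2 = 16 * α ^ 2 := by rw [mul_pow, sq_abs]; norm_num
  nlinarith [sq_nonneg (Real.exp δ - 1), Real.sin_sq_add_cos_sq (2 * Real.pi * α),
    mul_nonneg (sub_nonneg.mpr hr) (sub_nonneg.mpr (Real.cos_le_one (2 * Real.pi * α)))]

lemma geoKernel_mul (c : ℝ) (N : ℕ) (w : ℂ) :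
    geoKernel c N w * (Complex.exp w - 1) =
      Complex.exp (c * w) * (Complex.exp (((N + 1 : ℕ) : ℂ) * w) - 1) := by
  have h : geoKernel c N w =
      Complex.exp (c * w) * ∑ j ∈ Finset.range (N + 1), Complex.exp w ^ j := by
    rw [geoKernel, Finset.mul_sum]
    refine Finset.sum_congr rfl fun j _ => ?_
    rw [← Complex.exp_nat_mul, ← Complex.exp_add]
    push_cast; ring_nf
  rw [h, mul_assoc, geom_sum_mul, ← Complex.exp_nat_mul]

lemma norm_geoKernel_mul_norm_le {c : ℝ} (hc : 0 ≤ c) {N : ℕ} (hN : 0 < N) {α : ℝ}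
    (hα : |α| ≤ 1 / 2) :
    ‖geoKernel c N (linePt (1 / N) α)‖ * ‖linePt (1 / N) α‖ ≤
      2 * Real.exp (c + 1) + 2 * Real.exp c * (Real.exp 2 + 1) := by
  set w := linePt (1 / N) α with hw
  have hN' : (1 : ℝ) ≤ N := by exact_mod_cast hN
  have h1 := norm_geoKernel_le hc hN α
  have h2 : ‖geoKernel c N w‖ * (4 * |α|) ≤ Real.exp c * (Real.exp 2 + 1) := by
    calc _ ≤ ‖geoKernel c N w‖ * ‖Complex.exp w - 1‖ := by
          gcongr
          exact four_mul_abs_le_norm_exp_sub_one (by positivity) hα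
      _ = ‖Complex.exp (c * w)‖ * ‖Complex.exp (((N + 1 : ℕ) : ℂ) * w) - 1‖ := by
          rw [← norm_mul, geoKernel_mul, norm_mul]
      _ ≤ _ := by
          gcongr
          · rw [Complex.norm_exp, Complex.re_ofReal_mul, hw, linePt_re]
            refine Real.exp_le_exp.mpr ?_
            rw [mul_one_div]
            exact div_le_self hc hN'
          · refine (norm_sub_le _ _).trans ?_
            rw [norm_one, Complex.norm_exp, ← Complex.ofReal_natCast, Complex.re_ofReal_mul, hw,
              linePt_re]
            gcongr
            rw [mul_one_div, div_le_iff₀ (by positivity)]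
            push_cast; linarith
  have h3 : ‖w‖ ≤ 1 / N + 2 * Real.pi * |α| := by
    rw [hw, linePt]
    refine (norm_add_le _ _).trans (le_of_eq ?_)
    rw [Complex.norm_real, Real.norm_of_nonneg (by positivity), norm_mul, Complex.norm_I]
    simp [abs_of_pos Real.pi_pos]
  have hpi : Real.pi ≤ 4 := Real.pi_le_four
  have hpp := Real.pi_pos
  calc ‖geoKernel c N w‖ * ‖w‖ ≤ ‖geoKernel c N w‖ * (1 / N + 2 * Real.pi * |α|) := by gcongr
    _ = ‖geoKernel c N w‖ * (1 / N) + Real.pi / 2 * (‖geoKernel c N w‖ * (4 * |α|)) := by ring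
    _ ≤ (2 * Real.exp (c + 1) * N) * (1 / N) + 4 / 2 * (Real.exp c * (Real.exp 2 + 1)) := by gcongr
    _ = _ := by field_simp; ring

lemma integral_exp_int_mul_linePt (δ : ℝ) (m : ℤ) :
    ∫ α in (-(1 / 2) : ℝ)..(1 / 2), Complex.exp (m * linePt δ α) = if m = 0 then 1 else 0 := by
  split_ifs with h
  · subst h; norm_num
  · have hc : (m : ℂ) * (2 * Real.pi * Complex.I) ≠ 0 := by
      have : (m : ℂ) ≠ 0 := by exact_mod_cast h
      exact mul_ne_zero this Complex.two_pi_I_ne_zero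
    have e : ∀ α : ℝ, Complex.exp (m * linePt δ α) =
        Complex.exp (m * δ) * Complex.exp ((m : ℂ) * (2 * Real.pi * Complex.I) * α) := fun α => by
      rw [← Complex.exp_add, linePt]; ring_nf
    simp_rw [e]
    rw [intervalIntegral.integral_const_mul, integral_exp_mul_complex hc]
    have : Complex.exp ((m : ℂ) * (2 * Real.pi * Complex.I) * ((1 / 2 : ℝ) : ℂ)) =
        Complex.exp ((m : ℂ) * (2 * Real.pi * Complex.I) * ((-(1 / 2) : ℝ) : ℂ)) := by
      rw [Complex.exp_eq_exp_iff_exists_int]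
      exact ⟨m, by push_cast; ring⟩
    rw [this, sub_self, zero_div, mul_zero]

lemma integral_exp_mul_geoKernel (δ c : ℝ) (N Q : ℕ) :
    ∫ α in (-(1 / 2) : ℝ)..(1 / 2), Complex.exp (-linePt δ α * ((Q : ℝ) + c : ℝ)) *
      geoKernel c N (linePt δ α) = if Q ≤ N then 1 else 0 := by
  have e : ∀ α : ℝ, Complex.exp (-linePt δ α * ((Q : ℝ) + c : ℝ)) * geoKernel c N (linePt δ α) =
      ∑ j ∈ Finset.range (N + 1), Complex.exp (((j - Q : ℤ) : ℂ) * linePt δ α) := fun α => by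
    rw [geoKernel, Finset.mul_sum]
    refine Finset.sum_congr rfl fun j _ => ?_
    rw [← Complex.exp_add]; push_cast; ring_nf
  simp_rw [e]
  rw [intervalIntegral.integral_finsetSum fun j _ =>
    (Continuous.intervalIntegrable (by fun_prop) _ _)]
  simp_rw [integral_exp_int_mul_linePt, sub_eq_zero, Nat.cast_inj]
  rw [Finset.sum_ite_eq' ]
  simp

/-- Extraction of the partial sums of the coefficients of a generalized Dirichlet series. -/
lemma integral_tsum_mul_geoKernel {ι : Type*} [Countable ι] (W : ι → ℝ) (Q : ι → ℕ) (c : ℝ)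
    {δ : ℝ} (hW : ∀ b, 0 ≤ W b) (hsum : Summable fun b => W b * Real.exp (-δ * (Q b + c)))
    (N : ℕ) :
    ∫ α in (-(1 / 2) : ℝ)..(1 / 2),
      (∑' b, (W b : ℂ) * Complex.exp (-linePt δ α * ((Q b : ℝ) + c : ℝ))) *
        geoKernel c N (linePt δ α) = ((∑' b, if Q b ≤ N then W b else 0 : ℝ) : ℂ) := by
  have hnorm : ∀ b α, ‖(W b : ℂ) * Complex.exp (-linePt δ α * ((Q b : ℝ) + c : ℝ))‖ =
      W b * Real.exp (-δ * (Q b + c)) := fun b α => by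
    rw [norm_mul, Complex.norm_real, Real.norm_of_nonneg (hW b), Complex.norm_exp,
      Complex.re_mul_ofReal, Complex.neg_re, linePt_re]
  obtain ⟨K, hK⟩ := isCompact_uIcc.exists_bound_of_continuousOn
    (f := fun α => geoKernel c N (linePt δ α)) (s := Set.uIcc (-(1 / 2) : ℝ) (1 / 2))
    (Continuous.continuousOn (by fun_prop))
  have h := intervalIntegral.hasSum_integral_of_dominated_convergence (μ := volume)
    (a := (-(1 / 2) : ℝ)) (b := 1 / 2)
    (F := fun b α => (W b : ℂ) * Complex.exp (-linePt δ α * ((Q b : ℝ) + c : ℝ)) *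
      geoKernel c N (linePt δ α))
    (f := fun α => (∑' b, (W b : ℂ) * Complex.exp (-linePt δ α * ((Q b : ℝ) + c : ℝ))) *
        geoKernel c N (linePt δ α))
    (fun b _ => W b * Real.exp (-δ * (Q b + c)) * K)
    (fun b => Continuous.aestronglyMeasurable (by fun_prop))
    (fun b => ae_of_all _ fun α hα => by
      rw [norm_mul, hnorm]
      exact mul_le_mul_of_nonneg_left (hK α (Set.uIoc_subset_uIcc hα))
        (mul_nonneg (hW b) (Real.exp_pos _).le))
    (ae_of_all _ fun α _ => hsum.mul_right K)
    intervalIntegrable_const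
    (ae_of_all _ fun α _ => by
      refine (Summable.hasSum ?_).mul_right _
      exact Summable.of_norm (hsum.congr fun b => (hnorm b α).symm))
  rw [← h.tsum_eq, Complex.ofReal_tsum]
  refine tsum_congr fun b => ?_
  simp only [mul_assoc]
  rw [intervalIntegral.integral_const_mul, integral_exp_mul_geoKernel]
  split_ifs <;> simp

lemma summable_norm_prod_pi : ∀ {n : ℕ} {f : Fin n → ℤ → ℂ}, (∀ i, Summable fun b => ‖f i b‖) →
    (Summable fun b : Fin n → ℤ => ‖∏ i, f i (b i)‖) ∧
      ∏ i, ∑' b, f i b = ∑' b : Fin n → ℤ, ∏ i, f i (b i)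
  | 0, f, _ => by
    refine ⟨Summable.of_finite, ?_⟩
    rw [tsum_fintype]
    simp
  | n + 1, f, hf => by
    obtain ⟨h1, h2⟩ := summable_norm_prod_pi (f := fun i => f i.succ) fun i => hf i.succ
    have hs := (hf 0).mul_norm h1
    refine ⟨?_, ?_⟩
    · rw [← (Fin.consEquiv (fun _ : Fin (n + 1) => ℤ)).summable_iff]
      refine hs.congr fun p => ?_
      simp [Fin.prod_univ_succ, Fin.consEquiv]
    · rw [Fin.prod_univ_succ, h2, tsum_mul_tsum_of_summable_norm (hf 0) h1,
        ← (Fin.consEquiv (fun _ : Fin (n + 1) => ℤ)).tsum_eq]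
      refine tsum_congr fun p => ?_
      simp [Fin.prod_univ_succ, Fin.consEquiv]

section Counting

variable {n : ℕ} (k : Fin n → ℕ)

/-- The weight `∏ (bᵢ + 1/2) ^ (2 kᵢ)`. -/
noncomputable def halfWeight (b : Fin n → ℤ) : ℝ := ∏ i, (((b i : ℝ) + 1 / 2) ^ 2) ^ k i

lemma halfWeight_nonneg (b : Fin n → ℤ) : 0 ≤ halfWeight k b :=
  Finset.prod_nonneg fun i _ => by positivity

/-- The natural number `∑ bᵢ (bᵢ + 1) = ∑ (bᵢ + 1/2)² - n/4`. -/
def halfNorm (b : Fin n → ℤ) : ℕ := (∑ i, b i * (b i + 1)).toNat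

lemma halfNorm_add (b : Fin n → ℤ) :
    (halfNorm b : ℝ) + n / 4 = ∑ i, ((b i : ℝ) + 1 / 2) ^ 2 := by
  have h : ((halfNorm b : ℕ) : ℤ) = ∑ i, b i * (b i + 1) := by
    refine Int.toNat_of_nonneg (Finset.sum_nonneg fun i _ => ?_)
    rcases le_or_gt 0 (b i) with h | h <;> nlinarith
  have h' : (halfNorm b : ℝ) = ∑ i, (b i : ℝ) * (b i + 1) := by
    rw [← Int.cast_natCast, h]; push_cast; rfl
  have h4 : (n : ℝ) / 4 = ∑ i : Fin n, (1 / 4 : ℝ) := by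
    rw [Finset.sum_const, Finset.card_univ, Fintype.card_fin, nsmul_eq_mul]; ring
  rw [h', h4, ← Finset.sum_add_distrib]
  exact Finset.sum_congr rfl fun i _ => by ring

lemma prod_halfTheta_term (w : ℂ) (b : Fin n → ℤ) :
    ∏ i, ((((b i : ℂ) + 1 / 2) ^ 2) ^ k i * Complex.exp (-w * ((b i : ℂ) + 1 / 2) ^ 2)) =
      (halfWeight k b : ℂ) * Complex.exp (-w * ((halfNorm b : ℝ) + (n / 4 : ℝ) : ℝ)) := by
  rw [halfNorm_add, Finset.prod_mul_distrib, ← Complex.exp_sum, halfWeight, ← Finset.mul_sum]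
  push_cast
  rfl

lemma prod_halfTheta {w : ℂ} (hw : 0 < w.re) :
    (Summable fun b : Fin n → ℤ => halfWeight k b * Real.exp (-w.re * (halfNorm b + n / 4))) ∧
    ∏ i, halfTheta (k i) w = ∑' b : Fin n → ℤ,
      (halfWeight k b : ℂ) * Complex.exp (-w * ((halfNorm b : ℝ) + (n / 4 : ℝ) : ℝ)) := by
  have h := summable_norm_prod_pi (n := n)
    (f := fun i b => (((b : ℂ) + 1 / 2) ^ 2) ^ k i * Complex.exp (-w * ((b : ℂ) + 1 / 2) ^ 2))
    (fun i => (summable_halfTheta (k i) hw).norm)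
  refine ⟨h.1.congr fun b => ?_, ?_⟩
  · rw [prod_halfTheta_term, norm_mul, Complex.norm_real,
      Real.norm_of_nonneg (halfWeight_nonneg k b), Complex.norm_exp, Complex.re_mul_ofReal,
      Complex.neg_re]
  · simp_rw [halfTheta, h.2, prod_halfTheta_term]

/-- The weighted count of points of `(ℤ + 1/2)ⁿ` with `|x|² ≤ N + n/4`. -/
noncomputable def halfCount (N : ℕ) : ℝ :=
  ∑' b : Fin n → ℤ, if halfNorm b ≤ N then halfWeight k b else 0

lemma integral_prod_halfTheta_mul_geoKernel {δ : ℝ} (hδ : 0 < δ) (N : ℕ) :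
    ∫ α in (-(1 / 2) : ℝ)..(1 / 2), (∏ i, halfTheta (k i) (linePt δ α)) *
      geoKernel (n / 4) N (linePt δ α) = (halfCount k N : ℂ) := by
  have h := (prod_halfTheta k (w := linePt δ 0) (by simpa using hδ)).1
  rw [linePt_re] at h
  rw [halfCount, ← integral_tsum_mul_geoKernel _ _ _ (halfWeight_nonneg k) h N]
  refine intervalIntegral.integral_congr fun α _ => ?_
  rw [(prod_halfTheta k (w := linePt δ α) (by simpa using hδ)).2]

end Counting

section CircleMethod

variable {n : ℕ} (k : Fin n → ℕ)

lemma sqrt_pow_eq_rpow (n : ℕ) {x : ℝ} (hx : 0 ≤ x) : √x ^ n = x ^ ((n : ℝ) / 2) := by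
  rw [Real.sqrt_eq_rpow, ← Real.rpow_natCast, ← Real.rpow_mul hx]; ring_nf

/-- The contribution of the arc centred at `a / q` to the error. -/
noncomputable def arcBound (p : ℝ) (N q : ℕ) (a : ℤ) (α : ℝ) : ℝ :=
  (q : ℝ) ^ (1 - p) / |(a : ℝ)| * ‖linePt (1 / N) (α - a / q)‖ ^ (-p)

lemma arcBound_nonneg (p : ℝ) (N q : ℕ) (a : ℤ) (α : ℝ) : 0 ≤ arcBound p N q a α := by
  unfold arcBound; positivity

/-- The error of the main term on the line `re w = 1 / N`. -/
noncomputable def lineBound (p : ℝ) (N : ℕ) (α : ℝ) : ℝ :=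
  N * ‖linePt (1 / N) α‖ ^ (1 - p) +
    ∑ q ∈ Finset.Icc 1 (Nat.sqrt N), ∑ a ∈ Finset.Icc (-(q : ℤ)) q, arcBound p N q a α

lemma le_lineBound_left (p : ℝ) (N : ℕ) (α : ℝ) :
    N * ‖linePt (1 / N) α‖ ^ (1 - p) ≤ lineBound p N α :=
  le_add_of_nonneg_right
    (Finset.sum_nonneg fun _ _ => Finset.sum_nonneg fun _ _ => arcBound_nonneg _ _ _ _ _)

lemma add_arcBound_le_lineBound (p : ℝ) {N q : ℕ} {a : ℤ} (hq : q ∈ Finset.Icc 1 (Nat.sqrt N))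
    (ha : a ∈ Finset.Icc (-(q : ℤ)) q) (α : ℝ) :
    N * ‖linePt (1 / N) α‖ ^ (1 - p) + arcBound p N q a α ≤ lineBound p N α := by
  refine add_le_add le_rfl ?_
  refine (Finset.single_le_sum (f := fun a => arcBound p N q a α)
    (fun _ _ => arcBound_nonneg _ _ _ _ _) ha).trans ?_
  exact Finset.single_le_sum (f := fun q : ℕ => ∑ a ∈ Finset.Icc (-(q : ℤ)) q, arcBound p N q a α)
    (fun _ _ => Finset.sum_nonneg fun _ _ => arcBound_nonneg _ _ _ _ _) hq

lemma exists_dirichlet_approx {N : ℕ} (hN : 0 < N) (α : ℝ) (hα : |α| ≤ 1 / 2) :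
    ∃ (q : ℕ) (a : ℤ), q ∈ Finset.Icc 1 (Nat.sqrt N) ∧ a ∈ Finset.Icc (-(q : ℤ)) q ∧
      IsCoprime a (q : ℤ) ∧
      (q : ℝ) ^ 2 * ‖linePt (1 / N) (α - a / q)‖ ^ 2 ≤ (1 + 4 * Real.pi ^ 2) * (1 / N) ∧
      (a = 0 → q = 1) ∧ (a ≠ 0 → |(a : ℝ)| / q ≤ ‖linePt (1 / N) α‖) := by
  have hQ : 0 < Nat.sqrt N := Nat.sqrt_pos.mpr hN
  obtain ⟨r, hr, hrd⟩ := Real.exists_rat_abs_sub_le_and_den_le α hQ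
  set Q := Nat.sqrt N with hQdef
  have hQ1 : (1 : ℝ) ≤ Q := by exact_mod_cast hQ
  have hN' : (0 : ℝ) < N := by exact_mod_cast hN
  have hq0 : (0 : ℝ) < r.den := by exact_mod_cast r.den_pos
  have hra : (r : ℝ) = (r.num : ℝ) / r.den := by exact_mod_cast (Rat.num_div_den r).symm
  rw [hra] at hr
  have hqQ : (r.den : ℝ) ≤ Q := by exact_mod_cast hrd
  have hβ : |α - r.num / r.den| * r.den ≤ 1 / (Q + 1) := by
    calc _ ≤ 1 / (((Q : ℝ) + 1) * r.den) * r.den := by gcongr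
      _ = 1 / ((Q : ℝ) + 1) := by field_simp
  have hβ2 : |α - r.num / r.den| * r.den ≤ 1 / 2 :=
    hβ.trans (one_div_le_one_div_of_le (by norm_num) (by linarith))
  have habs : |(r.num : ℝ)| = |(r.num : ℝ) / r.den| * r.den := by
    rw [abs_div, abs_of_pos hq0]; field_simp
  have htri1 : |(r.num : ℝ) / r.den| ≤ |α| + |α - r.num / r.den| := by
    have := abs_sub_abs_le_abs_sub ((r.num : ℝ) / r.den) α
    rw [abs_sub_comm] at this; linarith
  refine ⟨r.den, r.num, Finset.mem_Icc.mpr ⟨r.den_pos, hrd⟩, ?_, r.isCoprime_num_den, ?_, ?_, ?_⟩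
  · have h1 : |(r.num : ℝ)| ≤ r.den := by
      rw [habs]
      have : (1 : ℝ) ≤ r.den := by exact_mod_cast r.den_pos
      nlinarith
    have h2 : |r.num| ≤ (r.den : ℤ) := by exact_mod_cast h1
    exact Finset.mem_Icc.mpr (abs_le.mp h2)
  · rw [norm_linePt_sq]
    have h1 : (r.den : ℝ) ^ 2 ≤ N := by
      have : Q ^ 2 ≤ N := Nat.sqrt_le' N
      calc (r.den : ℝ) ^ 2 ≤ (Q : ℝ) ^ 2 := by gcongr
        _ ≤ (N : ℝ) := by exact_mod_cast this
    have h2 : (N : ℝ) ≤ (Q + 1 : ℝ) ^ 2 := by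
      have : N < (Q + 1) ^ 2 := Nat.lt_succ_sqrt' N
      exact_mod_cast this.le
    have h3 : (α - r.num / r.den) ^ 2 * (r.den : ℝ) ^ 2 ≤ 1 / N := by
      calc _ = (|α - r.num / r.den| * r.den) ^ 2 := by rw [mul_pow, sq_abs]
        _ ≤ (1 / (Q + 1)) ^ 2 := by gcongr
        _ = 1 / (Q + 1 : ℝ) ^ 2 := by rw [div_pow, one_pow]
        _ ≤ 1 / N := one_div_le_one_div_of_le hN' h2
    have h4 : (r.den : ℝ) ^ 2 * (1 / N) ^ 2 ≤ 1 / N := by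
      calc (r.den : ℝ) ^ 2 * (1 / N) ^ 2 ≤ (N : ℝ) * (1 / N) ^ 2 := by gcongr
        _ = 1 / (N : ℝ) := by field_simp
    nlinarith [Real.pi_pos, sq_nonneg Real.pi]
  · intro h0
    have : r = 0 := Rat.num_eq_zero.mp h0
    rw [this]; rfl
  · intro h0
    refine le_trans ?_ (abs_le_norm_linePt _ _)
    have ha1 : (1 : ℝ) ≤ |(r.num : ℝ)| := by exact_mod_cast Int.one_le_abs h0
    have h5 : |(r.num : ℝ)| / r.den = |(r.num : ℝ) / r.den| := by rw [abs_div, abs_of_pos hq0]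
    rw [div_le_iff₀ hq0]
    nlinarith [Real.pi_gt_three, abs_nonneg α, mul_nonneg (abs_nonneg α) hq0.le]

lemma norm_prod_thetaMain_le {w : ℂ} (hw : 0 < w.re) :
    ‖∏ i, thetaMain (k i) w‖ ≤
      (∏ i, Real.Gamma (k i + 1 / 2)) * (1 / w.re) ^ (∑ i, k i) * ‖w‖ ^ (-((n : ℝ) / 2)) := by
  have hwn : 0 < ‖w‖ := hw.trans_le (Complex.re_le_norm w)
  have hG : 0 ≤ ∏ i, Real.Gamma (k i + 1 / 2) :=
    Finset.prod_nonneg fun i _ => (Real.Gamma_pos_of_pos (by positivity)).le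
  rw [prod_thetaMain k hw, norm_mul, Complex.norm_real, Real.norm_of_nonneg hG,
    ← Complex.ofReal_neg, Complex.norm_cpow_real, Fintype.card_fin, neg_add, Real.rpow_add hwn,
    ← mul_assoc, Real.rpow_neg hwn.le, Real.rpow_natCast, ← inv_pow, ← one_div]
  gcongr
  exact Complex.re_le_norm w

lemma exists_norm_circle_error_le (hn : 5 ≤ n) :
    ∃ C : ℝ, 0 ≤ C ∧ ∀ N : ℕ, 0 < N → ∀ α : ℝ,
      ‖(Set.Ioc (-(1 / 2) : ℝ) (1 / 2)).indicator (fun α => (∏ i, halfTheta (k i) (linePt (1 / N) α)) *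
          geoKernel (n / 4) N (linePt (1 / N) α)) α -
        (∏ i, thetaMain (k i) (linePt (1 / N) α)) * geoKernel (n / 4) N (linePt (1 / N) α)‖ ≤
      C * (N : ℝ) ^ (∑ i, k i) * lineBound (n / 2) N α := by
  set B : ℝ := 1 + 4 * Real.pi ^ 2 with hB
  have hB0 : 0 ≤ B := by positivity
  obtain ⟨C₁, hC₁, h₁⟩ := exists_norm_prod_halfTheta_rat_le k hB0
  obtain ⟨C₂, hC₂, h₂⟩ := exists_norm_prod_halfTheta_sub_le k hB0
  set c : ℝ := (n : ℝ) / 4 with hc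
  have hc0 : 0 ≤ c := by positivity
  set G : ℝ := ∏ i, Real.Gamma (k i + 1 / 2) with hG
  have hG0 : 0 ≤ G := Finset.prod_nonneg fun i _ => (Real.Gamma_pos_of_pos (by positivity)).le
  set D₁ : ℝ := 2 * Real.exp (c + 1) with hD₁
  set D₂ : ℝ := 2 * Real.exp (c + 1) + 2 * Real.exp c * (Real.exp 2 + 1) with hD₂
  have hD₁0 : 0 ≤ D₁ := by positivity
  have hD₂0 : 0 ≤ D₂ := by positivity
  set p : ℝ := (n : ℝ) / 2 with hp
  refine ⟨C₂ * D₂ + C₁ * D₂ + G * D₂ + G * D₁, by positivity, fun N hN α => ?_⟩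
  set δ : ℝ := 1 / N with hδ
  have hN' : (0 : ℝ) < N := by exact_mod_cast hN
  have hδ0 : 0 < δ := by positivity
  have hNδ : 1 / δ = N := by rw [hδ, one_div_one_div]
  set w := linePt δ α with hw
  have hwre : w.re = δ := linePt_re δ α
  have hwn : 0 < ‖w‖ := norm_linePt_pos hδ0 α
  set K := ∑ i, k i with hK
  set Dw := geoKernel c N w with hDw
  have hM := norm_prod_thetaMain_le k (w := w) (by rw [hwre]; exact hδ0)
  rw [hwre, hNδ, ← hG, ← hp, ← hK] at hM
  have hL0 := le_lineBound_left p N α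
  rw [← hδ, ← hw] at hL0
  have hX0 : 0 ≤ (N : ℝ) * ‖w‖ ^ (1 - p) := by positivity
  have hNK : (0 : ℝ) ≤ (N : ℝ) ^ K := by positivity
  have hfin : ∀ {C X : ℝ}, 0 ≤ X → X ≤ lineBound p N α →
      C ≤ C₂ * D₂ + C₁ * D₂ + G * D₂ + G * D₁ → C * N ^ K * X ≤
      (C₂ * D₂ + C₁ * D₂ + G * D₂ + G * D₁) * (N : ℝ) ^ K * lineBound p N α := by
    intro C X h0 h1 h2
    gcongr
  have hs1 : 0 ≤ C₂ * D₂ := by positivity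
  have hs2 : 0 ≤ C₁ * D₂ := by positivity
  have hs3 : 0 ≤ G * D₂ := by positivity
  have hs4 : 0 ≤ G * D₁ := by positivity
  have hpow1 : ‖w‖ ^ (1 - p) = ‖w‖ * ‖w‖ ^ (-p) := by
    rw [sub_eq_add_neg, Real.rpow_add hwn, Real.rpow_one]
  by_cases hα : α ∈ Set.Ioc (-(1 / 2) : ℝ) (1 / 2)
  swap
  · rw [Set.indicator_of_notMem hα, zero_sub, norm_neg, norm_mul]
    have hD := norm_geoKernel_le hc0 hN α
    have h1 : 1 ≤ ‖w‖ := by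
      refine le_trans ?_ (abs_le_norm_linePt δ α)
      have : 1 / 2 ≤ |α| := by
        by_contra! h
        exact hα ⟨(abs_lt.mp h).1, (abs_lt.mp h).2.le⟩
      nlinarith [Real.pi_gt_three]
    refine le_trans ?_ (hfin hX0 hL0 (by linarith : G * D₁ ≤ _))
    calc _ ≤ (G * N ^ K * ‖w‖ ^ (-p)) * (D₁ * N) := by gcongr
      _ = G * D₁ * N ^ K * (N * (1 * ‖w‖ ^ (-p))) := by ring
      _ ≤ _ := by rw [hpow1]; gcongr
  rw [Set.indicator_of_mem hα]
  have hα' : |α| ≤ 1 / 2 := abs_le.mpr ⟨hα.1.le, hα.2⟩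
  have hD : ‖Dw‖ ≤ D₂ / ‖w‖ := by
    rw [le_div_iff₀ hwn]
    exact norm_geoKernel_mul_norm_le hc0 hN hα'
  obtain ⟨q, a, hq, ha, hcop, happ, hq1, hlow⟩ := exists_dirichlet_approx hN α hα'
  rw [← hδ, ← hB] at happ
  rw [← hδ, ← hw] at hlow
  have hq0 : 0 < q := (Finset.mem_Icc.mp hq).1
  have hq0' : (0 : ℝ) < q := by exact_mod_cast hq0
  by_cases ha0 : a = 0
  · rw [hq1 ha0, ha0] at happ
    simp only [Nat.cast_one, one_pow, one_mul, Int.cast_zero, zero_div, sub_zero, ← hw] at happ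
    have h := h₂ w (by rw [hwre]; exact hδ0) (by rw [hwre]; exact happ)
    rw [← sub_mul, norm_mul]
    refine le_trans ?_ (hfin hX0 hL0 (by linarith : C₂ * D₂ ≤ _))
    rw [hwre, Fintype.card_fin, sqrt_pow_eq_rpow n hwn.le, ← hp] at h
    calc _ ≤ (C₂ / δ ^ K / ‖w‖ ^ p * (‖w‖ ^ 2 / δ)) * (D₂ / ‖w‖) := by gcongr
      _ = C₂ * D₂ * (1 / δ) ^ K * ((1 / δ) * (‖w‖ * (‖w‖ ^ p)⁻¹)) := by
          rw [one_div δ, inv_pow]; field_simp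
      _ = _ := by rw [hNδ, hpow1, Real.rpow_neg hwn.le]
  · have hlow := hlow ha0
    set w₀ := linePt δ (α - a / q) with hw₀
    have hw₀re : w₀.re = δ := linePt_re _ _
    have hw₀n : 0 < ‖w₀‖ := norm_linePt_pos hδ0 _
    have hww : w = w₀ + 2 * Real.pi * Complex.I * a / q := by
      rw [hw, hw₀, linePt, linePt]; push_cast; ring
    have h := h₁ w₀ q a (by rw [hw₀re]; exact hδ0) hq0 hcop (by rw [hw₀re]; exact happ)
    rw [← hww, hw₀re, Fintype.card_fin, sqrt_pow_eq_rpow n (by positivity), ← hp,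
      Real.mul_rpow hq0'.le hw₀n.le] at h
    have haa : (1 : ℝ) ≤ |(a : ℝ)| := by exact_mod_cast Int.one_le_abs ha0
    have hDa : ‖Dw‖ ≤ D₂ * (q / |(a : ℝ)|) := by
      refine hD.trans ?_
      rw [div_eq_mul_inv]
      gcongr
      rw [← inv_div]
      exact inv_anti₀ (by positivity) hlow
    have hNw : 1 ≤ N * ‖w‖ ^ 2 := by
      have hqN : (q : ℝ) ^ 2 ≤ N := by
        have : q ^ 2 ≤ N := (Nat.pow_le_pow_left (Finset.mem_Icc.mp hq).2 2).trans (Nat.sqrt_le' N)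
        exact_mod_cast this
      have h1 : 1 ≤ q * ‖w‖ := by
        rw [div_le_iff₀ hq0'] at hlow
        linarith
      calc (1 : ℝ) ≤ (q * ‖w‖) ^ 2 := one_le_pow₀ h1
        _ = q ^ 2 * ‖w‖ ^ 2 := by ring
        _ ≤ _ := by gcongr
    refine (norm_sub_le _ _).trans ?_
    rw [norm_mul, norm_mul]
    have e1 : ‖∏ i, halfTheta (k i) w‖ * ‖Dw‖ ≤ C₁ * D₂ * N ^ K * arcBound p N q a α := by
      calc _ ≤ (C₁ / δ ^ K / ((q : ℝ) ^ p * ‖w₀‖ ^ p)) * (D₂ * (q / |(a : ℝ)|)) := by gcongr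
        _ = C₁ * D₂ * (1 / δ) ^ K * ((q * ((q : ℝ) ^ p)⁻¹) / |(a : ℝ)| * (‖w₀‖ ^ p)⁻¹) := by
            rw [one_div δ, inv_pow]; field_simp
        _ = _ := by
            rw [hNδ, arcBound, sub_eq_add_neg, Real.rpow_add hq0', Real.rpow_one,
              Real.rpow_neg hq0'.le, Real.rpow_neg (norm_nonneg _)]
    have e2 : ‖∏ i, thetaMain (k i) w‖ * ‖Dw‖ ≤ G * D₂ * N ^ K * (N * ‖w‖ ^ (1 - p)) := by
      calc _ ≤ (G * N ^ K * ‖w‖ ^ (-p)) * (D₂ / ‖w‖) := by gcongr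
        _ = G * D₂ * N ^ K * (1 * ‖w‖ ^ (-p) / ‖w‖) := by ring
        _ ≤ G * D₂ * N ^ K * ((N * ‖w‖ ^ 2) * ‖w‖ ^ (-p) / ‖w‖) := by gcongr
        _ = _ := by rw [hpow1]; field_simp
    have hsum := add_arcBound_le_lineBound p hq ha α
    rw [← hδ, ← hw] at hsum
    have harc := arcBound_nonneg p N q a α
    calc _ ≤ C₁ * D₂ * N ^ K * arcBound p N q a α + G * D₂ * N ^ K * (N * ‖w‖ ^ (1 - p)) :=
          add_le_add e1 e2
      _ ≤ (C₂ * D₂ + C₁ * D₂ + G * D₂ + G * D₁) * N ^ K * arcBound p N q a α +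
          (C₂ * D₂ + C₁ * D₂ + G * D₂ + G * D₁) * N ^ K * (N * ‖w‖ ^ (1 - p)) := by
          gcongr <;> linarith
      _ = (C₂ * D₂ + C₁ * D₂ + G * D₂ + G * D₁) * N ^ K *
          (N * ‖w‖ ^ (1 - p) + arcBound p N q a α) := by ring
      _ ≤ _ := by gcongr

end CircleMethod

lemma exists_sum_arc_weight_le {p : ℝ} (hp : 5 / 2 ≤ p) : ∃ C : ℝ, 0 ≤ C ∧ ∀ Q : ℕ,
    ∑ q ∈ Finset.Icc 1 Q, ∑ a ∈ Finset.Icc (-(q : ℤ)) q, (q : ℝ) ^ (1 - p) / |(a : ℝ)| ≤ C := by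
  have hS₁ : Summable fun q : ℕ => (q : ℝ) ^ (-(11 / 8) : ℝ) :=
    Real.summable_nat_rpow.mpr (by norm_num)
  have hS₂ : Summable fun a : ℤ => |(a : ℝ)| ^ (-(9 / 8) : ℝ) :=
    Real.summable_abs_int_rpow (by norm_num)
  have h0₁ : ∀ q : ℕ, 0 ≤ (q : ℝ) ^ (-(11 / 8) : ℝ) := fun q => by positivity
  have h0₂ : ∀ a : ℤ, 0 ≤ |(a : ℝ)| ^ (-(9 / 8) : ℝ) := fun a => by positivity
  refine ⟨(∑' q : ℕ, (q : ℝ) ^ (-(11 / 8) : ℝ)) * ∑' a : ℤ, |(a : ℝ)| ^ (-(9 / 8) : ℝ),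
    mul_nonneg (tsum_nonneg h0₁) (tsum_nonneg h0₂), fun Q => ?_⟩
  have key : ∀ q ∈ Finset.Icc 1 Q,
      ∑ a ∈ Finset.Icc (-(q : ℤ)) q, (q : ℝ) ^ (1 - p) / |(a : ℝ)| ≤
      (q : ℝ) ^ (-(11 / 8) : ℝ) * ∑' a : ℤ, |(a : ℝ)| ^ (-(9 / 8) : ℝ) := by
    intro q hq
    have hq1 : (1 : ℝ) ≤ q := by exact_mod_cast (Finset.mem_Icc.mp hq).1
    have hq0 : (0 : ℝ) < q := by linarith
    have : ∀ a ∈ Finset.Icc (-(q : ℤ)) q, (q : ℝ) ^ (1 - p) / |(a : ℝ)| ≤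
        (q : ℝ) ^ (-(11 / 8) : ℝ) * |(a : ℝ)| ^ (-(9 / 8) : ℝ) := by
      intro a ha
      rcases eq_or_ne a 0 with rfl | ha0
      · simp
      have haq : |(a : ℝ)| ≤ q := by exact_mod_cast abs_le.mpr (Finset.mem_Icc.mp ha)
      have ha1 : (0 : ℝ) < |(a : ℝ)| := by positivity
      have e1 : (q : ℝ) ^ (1 - p) ≤ (q : ℝ) ^ (-(3 / 2) : ℝ) :=
        Real.rpow_le_rpow_of_exponent_le hq1 (by linarith)
      have e2 : |(a : ℝ)| ^ (1 / 8 : ℝ) ≤ (q : ℝ) ^ (1 / 8 : ℝ) :=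
        Real.rpow_le_rpow ha1.le haq (by norm_num)
      have e3 : (|(a : ℝ)|)⁻¹ = |(a : ℝ)| ^ (-(9 / 8) : ℝ) * |(a : ℝ)| ^ (1 / 8 : ℝ) := by
        rw [← Real.rpow_add ha1, ← Real.rpow_neg_one]; norm_num
      have e4 : (q : ℝ) ^ (-(11 / 8) : ℝ) = (q : ℝ) ^ (-(3 / 2) : ℝ) * (q : ℝ) ^ (1 / 8 : ℝ) := by
        rw [← Real.rpow_add hq0]; norm_num
      rw [div_eq_mul_inv, e3, e4]
      calc _ ≤ (q : ℝ) ^ (-(3 / 2) : ℝ) *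
            (|(a : ℝ)| ^ (-(9 / 8) : ℝ) * (q : ℝ) ^ (1 / 8 : ℝ)) := by gcongr
        _ = _ := by ring
    refine (Finset.sum_le_sum this).trans ?_
    rw [← Finset.mul_sum]
    exact mul_le_mul_of_nonneg_left (hS₂.sum_le_tsum _ fun a _ => h0₂ a) (h0₁ q)
  refine (Finset.sum_le_sum key).trans ?_
  rw [← Finset.sum_mul]
  exact mul_le_mul_of_nonneg_right (hS₁.sum_le_tsum _ fun a _ => h0₁ a) (tsum_nonneg h0₂)

lemma integrable_arcBound {p : ℝ} (hp : 1 < p) {N : ℕ} (hN : 0 < N) (q : ℕ) (a : ℤ) :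
    Integrable (arcBound p N q a) :=
  (integrable_norm_linePt hp (by positivity) _).const_mul _

lemma one_div_rpow_one_sub {N : ℕ} (s : ℝ) :
    (1 / (N : ℝ)) ^ (1 - s) = (N : ℝ) ^ (s - 1) := by
  rw [one_div, Real.inv_rpow (by positivity), ← Real.rpow_neg (by positivity), neg_sub]

lemma integrable_norm_linePt_rpow_sub {p : ℝ} (hp : 2 < p) {N : ℕ} (hN : 0 < N) :
    Integrable fun α => (N : ℝ) * ‖linePt (1 / N) α‖ ^ (1 - p) := by
  have h := (integrable_norm_linePt (s := p - 1) (δ := 1 / N) (by linarith) (by positivity)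
    0).const_mul (N : ℝ)
  simpa only [sub_zero, neg_sub] using h

lemma integrable_lineBound {p : ℝ} (hp : 2 < p) {N : ℕ} (hN : 0 < N) :
    Integrable (lineBound p N) := by
  refine (integrable_norm_linePt_rpow_sub hp hN).add ?_
  exact integrable_finsetSum _ fun q _ => integrable_finsetSum _ fun a _ =>
    integrable_arcBound (by linarith) hN q a

lemma exists_integral_lineBound_le {p : ℝ} (hp : 5 / 2 ≤ p) : ∃ C : ℝ, 0 ≤ C ∧ ∀ N : ℕ, 0 < N →
    ∫ α, lineBound p N α ≤ C * (N : ℝ) ^ (p - 1) := by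
  obtain ⟨S, hS0, hS⟩ := exists_sum_arc_weight_le hp
  have hL := lineConst_nonneg p
  refine ⟨lineConst (p - 1) + S * lineConst p,
    add_nonneg (lineConst_nonneg _) (mul_nonneg hS0 hL), fun N hN => ?_⟩
  have hN' : (0 : ℝ) < N := by exact_mod_cast hN
  have h1 : ∫ α, (N : ℝ) * ‖linePt (1 / N) α‖ ^ (1 - p) = lineConst (p - 1) * (N : ℝ) ^ (p - 1) := by
    have h := integral_norm_linePt (s := p - 1) (δ := 1 / N) (by positivity) 0
    simp only [sub_zero, neg_sub] at h
    rw [integral_const_mul, h, one_div_rpow_one_sub, Real.rpow_sub_one hN'.ne']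
    field_simp
  have h2 : ∀ (q : ℕ) (a : ℤ), ∫ α, arcBound p N q a α =
      (q : ℝ) ^ (1 - p) / |(a : ℝ)| * (lineConst p * (N : ℝ) ^ (p - 1)) := fun q a => by
    simp only [arcBound]
    rw [integral_const_mul, integral_norm_linePt (by positivity), one_div_rpow_one_sub]
  have h3 : ∫ α, lineBound p N α = lineConst (p - 1) * (N : ℝ) ^ (p - 1) +
      (∑ q ∈ Finset.Icc 1 (Nat.sqrt N), ∑ a ∈ Finset.Icc (-(q : ℤ)) q,
        (q : ℝ) ^ (1 - p) / |(a : ℝ)|) * (lineConst p * (N : ℝ) ^ (p - 1)) := by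
    have hi : ∀ (q : ℕ) (a : ℤ), Integrable (fun α => arcBound p N q a α) := fun q a =>
      integrable_arcBound (by linarith) hN q a
    simp only [lineBound]
    rw [integral_add (integrable_norm_linePt_rpow_sub (by linarith) hN)
      (integrable_finsetSum _ fun q _ => integrable_finsetSum _ fun a _ => hi q a), h1,
      integral_finsetSum _ fun q _ => integrable_finsetSum _ fun a _ => hi q a]
    congr 1
    rw [Finset.sum_mul]
    refine Finset.sum_congr rfl fun q _ => ?_
    rw [integral_finsetSum _ fun a _ => hi q a, Finset.sum_mul]
    exact Finset.sum_congr rfl fun a _ => h2 q a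
  rw [h3]
  calc _ ≤ lineConst (p - 1) * (N : ℝ) ^ (p - 1) + S * (lineConst p * (N : ℝ) ^ (p - 1)) := by
        gcongr
        exact hS _
    _ = _ := by ring

section MainTerm

variable {n : ℕ} (k : Fin n → ℕ)

lemma integral_prod_thetaMain_mul_geoKernel {δ c : ℝ} (hn : 2 < n) (hδ : 0 < δ) (hc : 0 < c)
    (N : ℕ) :
    Integrable (fun α => (∏ i, thetaMain (k i) (linePt δ α)) * geoKernel c N (linePt δ α)) ∧
    ∫ α, (∏ i, thetaMain (k i) (linePt δ α)) * geoKernel c N (linePt δ α) =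
      (((∏ i, Real.Gamma (k i + 1 / 2)) / Real.Gamma ((∑ i, k i : ℕ) + (n : ℝ) / 2) *
        ∑ j ∈ Finset.range (N + 1), ((j : ℝ) + c) ^ ((∑ i, k i : ℕ) + (n : ℝ) / 2 - 1) : ℝ) : ℂ) := by
  set M : ℝ := (∑ i, k i : ℕ) + (n : ℝ) / 2 with hM
  set G : ℝ := ∏ i, Real.Gamma (k i + 1 / 2) with hG
  have hM1 : 1 < M := by
    have h1 : (2 : ℝ) < n := by exact_mod_cast hn
    have h2 : (0 : ℝ) ≤ (∑ i, k i : ℕ) := Nat.cast_nonneg _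
    linarith
  have hcont : Continuous fun α => linePt δ α ^ (-(M : ℂ)) :=
    Continuous.cpow (continuous_linePt δ) continuous_const fun α => Or.inl (by simpa using hδ)
  have hfint : Integrable fun α => ‖linePt δ α‖ ^ (-M) := by
    simpa using integrable_norm_linePt hM1 hδ 0
  have hi : ∀ y : ℝ, Integrable fun α => linePt δ α ^ (-(M : ℂ)) * Complex.exp (y * linePt δ α) := by
    intro y
    refine (hfint.mul_const (Real.exp (y * δ))).mono' (hcont.mul (by fun_prop)).aestronglyMeasurable
      (ae_of_all _ fun α => le_of_eq ?_)
    rw [norm_mul, ← Complex.ofReal_neg, Complex.norm_cpow_real, Complex.norm_exp,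
      Complex.re_ofReal_mul, linePt_re]
  have e : ∀ α, (∏ i, thetaMain (k i) (linePt δ α)) * geoKernel c N (linePt δ α) =
      ∑ j ∈ Finset.range (N + 1), (G : ℂ) *
        (linePt δ α ^ (-(M : ℂ)) * Complex.exp (((j : ℝ) + c : ℝ) * linePt δ α)) := fun α => by
    rw [prod_thetaMain k (by simpa using hδ), Fintype.card_fin, geoKernel, Finset.mul_sum]
    exact Finset.sum_congr rfl fun j _ => mul_assoc _ _ _
  simp_rw [e]
  refine ⟨integrable_finsetSum _ fun j _ => (hi _).const_mul _, ?_⟩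
  rw [integral_finsetSum _ fun j _ => (hi _).const_mul _, Finset.mul_sum, Complex.ofReal_sum]
  refine Finset.sum_congr rfl fun j _ => ?_
  rw [integral_const_mul, integral_linePt_cpow_mul_exp hM1 hδ (by positivity)]
  push_cast
  ring

lemma exists_halfCount_sub_sum_le (hn : 5 ≤ n) : ∃ C : ℝ, 0 ≤ C ∧ ∀ N : ℕ, 0 < N →
    |halfCount k N - (∏ i, Real.Gamma (k i + 1 / 2)) / Real.Gamma ((∑ i, k i : ℕ) + (n : ℝ) / 2) *
        ∑ j ∈ Finset.range (N + 1), ((j : ℝ) + n / 4) ^ ((∑ i, k i : ℕ) + (n : ℝ) / 2 - 1)| ≤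
      C * (N : ℝ) ^ ((∑ i, k i : ℕ) + (n : ℝ) / 2 - 1) := by
  have hn' : (5 : ℝ) ≤ n := by exact_mod_cast hn
  obtain ⟨C₁, hC₁, h₁⟩ := exists_norm_circle_error_le k hn
  obtain ⟨C₂, hC₂, h₂⟩ := exists_integral_lineBound_le (p := (n : ℝ) / 2) (by linarith)
  refine ⟨C₁ * C₂, by positivity, fun N hN => ?_⟩
  have hN' : (0 : ℝ) < N := by exact_mod_cast hN
  have hδ : (0 : ℝ) < 1 / N := by positivity
  obtain ⟨hi, hI⟩ := integral_prod_thetaMain_mul_geoKernel k (δ := 1 / N) (c := n / 4)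
    (by omega) hδ (by positivity) N
  have hcont : Continuous fun α => (∏ i, halfTheta (k i) (linePt (1 / N) α)) *
      geoKernel (n / 4) N (linePt (1 / N) α) := by
    refine Continuous.mul (continuous_finsetProd _ fun i _ => ?_) (by fun_prop)
    refine continuous_iff_continuousAt.mpr fun α => ?_
    exact ContinuousAt.comp (f := linePt (1 / N))
      (hasDerivAt_halfTheta (k i) (by simpa using hδ)).continuousAt (continuous_linePt _).continuousAt
  have hΘ : ∫ α, (Set.Ioc (-(1 / 2) : ℝ) (1 / 2)).indicator
      (fun α => (∏ i, halfTheta (k i) (linePt (1 / N) α)) *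
        geoKernel (n / 4) N (linePt (1 / N) α)) α = (halfCount k N : ℂ) := by
    rw [integral_indicator measurableSet_Ioc, ← intervalIntegral.integral_of_le (by norm_num),
      integral_prod_halfTheta_mul_geoKernel k hδ]
  have hΘi : Integrable ((Set.Ioc (-(1 / 2) : ℝ) (1 / 2)).indicator
      (fun α => (∏ i, halfTheta (k i) (linePt (1 / N) α)) *
        geoKernel (n / 4) N (linePt (1 / N) α))) :=
    (hcont.integrableOn_Icc.mono_set Set.Ioc_subset_Icc_self).integrable_indicator measurableSet_Ioc
  rw [← Real.norm_eq_abs, ← Complex.norm_real, Complex.ofReal_sub, ← hΘ, ← hI,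
    ← integral_sub hΘi hi]
  have hb := norm_integral_le_of_norm_le
    ((integrable_lineBound (p := (n : ℝ) / 2) (by linarith) hN).const_mul (C₁ * (N : ℝ) ^ (∑ i, k i)))
    (ae_of_all _ (h₁ N hN))
  refine hb.trans ?_
  rw [integral_const_mul, add_sub_assoc, Real.rpow_add hN', Real.rpow_natCast]
  calc _ ≤ C₁ * (N : ℝ) ^ (∑ i, k i) * (C₂ * (N : ℝ) ^ ((n : ℝ) / 2 - 1)) := by
        gcongr
        exact h₂ N hN
    _ = _ := by ring

end MainTerm

section PowerSum

/-- The tangent line inequality for the convex function `x ↦ x ^ M`. -/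
lemma rpow_add_mul_sub_mul_rpow_le {x y M : ℝ} (hx : 0 ≤ x) (hy : 0 < y) (hM : 1 ≤ M) :
    y ^ M + M * (x - y) * y ^ (M - 1) ≤ x ^ M := by
  have h := one_add_mul_self_le_rpow_one_add (s := x / y - 1) (p := M)
    (by have := div_nonneg hx hy.le; linarith) hM
  rw [add_sub_cancel, Real.div_rpow hx hy.le, le_div_iff₀ (by positivity)] at h
  refine le_of_eq_of_le ?_ h
  rw [Real.rpow_sub_one hy.ne']
  field_simp

lemma add_rpow_sub_rpow_le {x s a M : ℝ} (hx : 1 ≤ x) (hs : 0 ≤ s) (hsa : s ≤ a) (hM : 1 ≤ M) :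
    (x + s) ^ M - x ^ M ≤ M * a * (1 + a) ^ (M - 1) * x ^ (M - 1) := by
  have h := rpow_add_mul_sub_mul_rpow_le (x := x) (y := x + s) (M := M) (by linarith)
    (by linarith) hM
  have h2 : (x + s) ^ (M - 1) ≤ (1 + a) ^ (M - 1) * x ^ (M - 1) := by
    rw [← Real.mul_rpow (by linarith) (by linarith)]
    refine Real.rpow_le_rpow (by linarith) ?_ (by linarith)
    nlinarith
  have ha : 0 ≤ M * a := mul_nonneg (by linarith) (hs.trans hsa)
  calc (x + s) ^ M - x ^ M ≤ M * s * (x + s) ^ (M - 1) := by linarith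
    _ ≤ M * a * ((1 + a) ^ (M - 1) * x ^ (M - 1)) := by
        gcongr
    _ = _ := by ring

lemma mul_sum_add_rpow_le {c M : ℝ} (hc : 0 < c) (hM : 1 ≤ M) (N : ℕ) :
    M * ∑ j ∈ range (N + 1), ((j : ℝ) + c) ^ (M - 1) ≤ (N + (1 + c)) ^ M := by
  have h : ∀ j ∈ range (N + 1), M * ((j : ℝ) + c) ^ (M - 1) ≤
      (((j + 1 : ℕ) : ℝ) + c) ^ M - ((j : ℝ) + c) ^ M := fun j _ => by
    have := rpow_add_mul_sub_mul_rpow_le (x := ((j + 1 : ℕ) : ℝ) + c) (y := j + c) (M := M)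
      (by positivity) (by positivity) hM
    push_cast at this ⊢
    have e : M * ((j : ℝ) + 1 + c - (j + c)) = M := by ring
    rw [e] at this
    linarith
  rw [Finset.mul_sum]
  refine (Finset.sum_le_sum h).trans ?_
  rw [Finset.sum_range_sub (fun j : ℕ => ((j : ℝ) + c) ^ M)]
  push_cast
  have : 0 ≤ ((0 : ℝ) + c) ^ M := by positivity
  rw [add_assoc]
  linarith

lemma rpow_le_mul_sum_add_rpow {c M : ℝ} (hc : 0 < c) (hM : 1 ≤ M) (N : ℕ) :
    (N : ℝ) ^ M ≤ M * ∑ j ∈ range (N + 1), ((j : ℝ) + c) ^ (M - 1) := by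
  induction N with
  | zero =>
    rw [Nat.cast_zero, Real.zero_rpow (by linarith)]
    positivity
  | succ N ih =>
    rw [Finset.sum_range_succ, mul_add]
    have := rpow_add_mul_sub_mul_rpow_le (x := (N : ℝ)) (y := (N + 1 : ℕ)) (M := M)
      (by positivity) (by positivity) hM
    have h2 : (((N + 1 : ℕ) : ℝ)) ^ (M - 1) ≤ (((N + 1 : ℕ) : ℝ) + c) ^ (M - 1) :=
      Real.rpow_le_rpow (by positivity) (by linarith) (by linarith)
    have e : M * ((N : ℝ) - ((N + 1 : ℕ) : ℝ)) = -M := by push_cast; ring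
    rw [e] at this
    nlinarith

lemma exists_mul_sum_sub_rpow_le {c M : ℝ} (hc : 0 < c) (hM : 1 ≤ M) :
    ∃ C : ℝ, 0 ≤ C ∧ ∀ N : ℕ, 0 < N →
      |M * ∑ j ∈ range (N + 1), ((j : ℝ) + c) ^ (M - 1) - (N : ℝ) ^ M| ≤ C * (N : ℝ) ^ (M - 1) := by
  refine ⟨M * (1 + c) * (1 + (1 + c)) ^ (M - 1), by positivity, fun N hN => ?_⟩
  rw [abs_of_nonneg (sub_nonneg.2 (rpow_le_mul_sum_add_rpow hc hM N))]
  refine (sub_le_sub_right (mul_sum_add_rpow_le hc hM N) _).trans ?_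
  exact add_rpow_sub_rpow_le (by exact_mod_cast hN) (by linarith) le_rfl hM

end PowerSum

section BallMoments

variable {n : ℕ} (k : Fin n → ℕ)

lemma integrable_sq_pow_mul_exp_neg_sq (j : ℕ) :
    Integrable fun t : ℝ => (t ^ 2) ^ j * Real.exp (-t ^ 2) := by
  have h := integrable_rpow_mul_exp_neg_mul_sq (b := 1) one_pos (s := ((2 * j : ℕ) : ℝ))
    (by have : (0 : ℝ) ≤ ((2 * j : ℕ) : ℝ) := by positivity
        linarith)
  simpa only [Real.rpow_natCast, pow_mul, neg_one_mul] using h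

lemma integral_sq_pow_mul_exp_neg_sq (j : ℕ) :
    ∫ t : ℝ, (t ^ 2) ^ j * Real.exp (-t ^ 2) = Real.Gamma (j + 1 / 2) := by
  have hj : (0 : ℝ) ≤ ((2 * j : ℕ) : ℝ) := by positivity
  have h := integral_rpow_mul_exp_neg_rpow (p := 2) (q := ((2 * j : ℕ) : ℝ)) two_pos (by linarith)
  have h2 := integral_comp_abs (f := fun t => (t ^ 2) ^ j * Real.exp (-t ^ 2))
  simp only [sq_abs] at h2
  simp only [Real.rpow_natCast, pow_mul, Real.rpow_two] at h
  rw [h2, h]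
  push_cast
  rw [← mul_assoc, show (2 * (j : ℝ) + 1) / 2 = j + 1 / 2 by ring]
  norm_num

/-- The monomial `∏ (x i ^ 2) ^ k i`. -/
noncomputable def sqMonomial (x : EuclideanSpace ℝ (Fin n)) : ℝ := ∏ i, (x i ^ 2) ^ k i

lemma continuous_sqMonomial : Continuous (sqMonomial k) := by
  unfold sqMonomial
  fun_prop

lemma sqMonomial_nonneg (x : EuclideanSpace ℝ (Fin n)) : 0 ≤ sqMonomial k x :=
  Finset.prod_nonneg fun i _ => by positivity

lemma sqMonomial_smul (R : ℝ) (x : EuclideanSpace ℝ (Fin n)) :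
    sqMonomial k (R • x) = (R ^ 2) ^ (∑ i, k i) * sqMonomial k x := by
  simp [sqMonomial, mul_pow, Finset.prod_mul_distrib, Finset.prod_pow_eq_pow_sum]

lemma sqMonomial_mul_exp (x : EuclideanSpace ℝ (Fin n)) :
    sqMonomial k x * Real.exp (-‖x‖ ^ 2) =
      ∏ i, ((x i ^ 2) ^ k i * Real.exp (-x i ^ 2)) := by
  rw [Finset.prod_mul_distrib, ← Real.exp_sum, EuclideanSpace.norm_sq_eq, Finset.sum_neg_distrib]
  simp [sqMonomial]

lemma integrable_sqMonomial_mul_exp :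
    Integrable fun x : EuclideanSpace ℝ (Fin n) => sqMonomial k x * Real.exp (-‖x‖ ^ 2) := by
  simp_rw [sqMonomial_mul_exp]
  have h := Integrable.fintype_prod (μ := fun _ : Fin n => (volume : Measure ℝ))
    fun i => integrable_sq_pow_mul_exp_neg_sq (k i)
  exact ((EuclideanSpace.volume_preserving_symm_measurableEquiv_toLp (Fin n)).integrable_comp_emb
    (MeasurableEquiv.measurableEmbedding _)).2 h

lemma integral_sqMonomial_mul_exp :
    ∫ x : EuclideanSpace ℝ (Fin n), sqMonomial k x * Real.exp (-‖x‖ ^ 2) =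
      ∏ i, Real.Gamma (k i + 1 / 2) := by
  simp_rw [sqMonomial_mul_exp, ← integral_sq_pow_mul_exp_neg_sq]
  rw [← integral_fintype_prod_volume_eq_prod]
  exact (EuclideanSpace.volume_preserving_symm_measurableEquiv_toLp (Fin n)).integral_comp
    (MeasurableEquiv.measurableEmbedding _)
    fun x : Fin n → ℝ => ∏ i, ((x i ^ 2) ^ k i * Real.exp (-x i ^ 2))

lemma setIntegral_closedBall_sqrt_sqMonomial {t : ℝ} (ht : 0 < t) :
    ∫ x in Metric.closedBall (0 : EuclideanSpace ℝ (Fin n)) (√t), sqMonomial k x =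
      t ^ ((∑ i, k i : ℕ) + (n : ℝ) / 2) *
        ∫ x in Metric.closedBall (0 : EuclideanSpace ℝ (Fin n)) 1, sqMonomial k x := by
  have h := Measure.setIntegral_comp_smul_of_pos (volume : Measure (EuclideanSpace ℝ (Fin n)))
    (sqMonomial k) (Metric.closedBall 0 1) (Real.sqrt_pos.2 ht)
  have hs := (Real.sqrt_pos.2 ht)
  rw [smul_unitClosedBall, Real.norm_of_nonneg hs.le, finrank_euclideanSpace_fin] at h
  simp_rw [sqMonomial_smul, Real.sq_sqrt ht.le] at h
  rw [integral_const_mul, smul_eq_mul, eq_inv_mul_iff_mul_eq₀ (by positivity)] at h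
  rw [← h, Real.rpow_add ht, Real.rpow_natCast, ← mul_assoc, mul_comm (√t ^ n)]
  congr 2
  rw [Real.sqrt_eq_rpow, ← Real.rpow_mul_natCast ht.le]
  congr 1
  ring

/-- The layer-cake integrand whose two iterated integrals compute the Gaussian moment. -/
noncomputable def ballLayer (x : EuclideanSpace ℝ (Fin n)) (t : ℝ) : ℝ :=
  (Set.Ici (‖x‖ ^ 2)).indicator (fun t => sqMonomial k x * Real.exp (-t)) t

lemma integrable_ballLayer_right (x : EuclideanSpace ℝ (Fin n)) : Integrable (ballLayer k x) := by
  refine IntegrableOn.integrable_indicator ?_ measurableSet_Ici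
  exact ((integrableOn_Ici_iff_integrableOn_Ioi).2 (integrableOn_exp_neg_Ioi _)).const_mul _

lemma integral_ballLayer_right (x : EuclideanSpace ℝ (Fin n)) :
    ∫ t, ballLayer k x t = sqMonomial k x * Real.exp (-‖x‖ ^ 2) := by
  unfold ballLayer
  rw [integral_indicator measurableSet_Ici, integral_Ici_eq_integral_Ioi, integral_const_mul,
    integral_exp_neg_Ioi]

lemma ballLayer_nonneg (x : EuclideanSpace ℝ (Fin n)) (t : ℝ) : 0 ≤ ballLayer k x t :=
  Set.indicator_nonneg (fun _ _ => mul_nonneg (sqMonomial_nonneg k x) (Real.exp_pos _).le) _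

lemma integrable_ballLayer :
    Integrable (Function.uncurry (ballLayer k))
      ((volume : Measure (EuclideanSpace ℝ (Fin n))).prod volume) := by
  have hm : Measurable (Function.uncurry (ballLayer k)) := by
    have : Function.uncurry (ballLayer k) =
        {p : EuclideanSpace ℝ (Fin n) × ℝ | ‖p.1‖ ^ 2 ≤ p.2}.indicator
          (fun p => sqMonomial k p.1 * Real.exp (-p.2)) := by
      ext p
      simp only [Function.uncurry, ballLayer, Set.indicator, Set.mem_Ici, Set.mem_ofPred_eq]
    rw [this]
    refine Measurable.indicator ?_ (measurableSet_le (by fun_prop) (by fun_prop))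
    exact (((continuous_sqMonomial k).comp continuous_fst).mul (by fun_prop)).measurable
  rw [integrable_prod_iff hm.aestronglyMeasurable]
  refine ⟨ae_of_all _ (integrable_ballLayer_right k), ?_⟩
  simp only [Function.uncurry, Real.norm_of_nonneg (ballLayer_nonneg k _ _),
    integral_ballLayer_right]
  exact integrable_sqMonomial_mul_exp k

lemma integral_ballLayer_left {t : ℝ} (ht : 0 < t) :
    ∫ x, ballLayer k x t = Real.exp (-t) * t ^ ((∑ i, k i : ℕ) + (n : ℝ) / 2) *
      ∫ x in Metric.closedBall (0 : EuclideanSpace ℝ (Fin n)) 1, sqMonomial k x := by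
  rw [mul_assoc, ← setIntegral_closedBall_sqrt_sqMonomial k ht, ← integral_const_mul,
    ← integral_indicator Metric.isClosed_closedBall.measurableSet]
  congr 1
  ext x
  simp only [ballLayer, Set.indicator, Set.mem_Ici, Metric.mem_closedBall, dist_zero_right,
    mul_comm (Real.exp _)]
  rw [if_congr (Real.le_sqrt (norm_nonneg x) ht.le).symm rfl rfl]

lemma integral_ballLayer_left_of_neg {t : ℝ} (ht : t < 0) :
    ∫ x : EuclideanSpace ℝ (Fin n), ballLayer k x t = 0 := by
  have : ∀ x : EuclideanSpace ℝ (Fin n), ballLayer k x t = 0 := fun x =>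
    Set.indicator_of_notMem (by simpa using ht.trans_le (sq_nonneg ‖x‖)) _
  simp [this]

lemma setIntegral_sqMonomial_mul_Gamma :
    (∫ x in Metric.closedBall (0 : EuclideanSpace ℝ (Fin n)) 1, sqMonomial k x) *
      Real.Gamma ((∑ i, k i : ℕ) + (n : ℝ) / 2 + 1) = ∏ i, Real.Gamma (k i + 1 / 2) := by
  rw [← integral_sqMonomial_mul_exp]
  simp_rw [← integral_ballLayer_right]
  rw [integral_integral_swap (integrable_ballLayer k), Real.Gamma_eq_integral (by positivity),
    mul_comm, ← integral_mul_const, ← integral_indicator measurableSet_Ioi]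
  refine integral_congr_ae ?_
  filter_upwards [Measure.ae_ne volume (0 : ℝ)] with t ht
  rcases lt_or_gt_of_ne ht with h | h
  · rw [integral_ballLayer_left_of_neg k h, Set.indicator_of_notMem (by simpa using h.le)]
  · rw [Set.indicator_of_mem (Set.mem_Ioi.2 h), integral_ballLayer_left k h, add_sub_cancel_right]

/-- The lattice count for a monomial weight, with its volume main term. -/
lemma exists_halfCount_sub_rpow_le (hn : 5 ≤ n) : ∃ C : ℝ, 0 ≤ C ∧ ∀ N : ℕ, 0 < N →
    |halfCount k N - (∫ x in Metric.closedBall (0 : EuclideanSpace ℝ (Fin n)) 1, sqMonomial k x) *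
        (N : ℝ) ^ ((∑ i, k i : ℕ) + (n : ℝ) / 2)| ≤
      C * (N : ℝ) ^ ((∑ i, k i : ℕ) + (n : ℝ) / 2 - 1) := by
  have hn' : (5 : ℝ) ≤ n := by exact_mod_cast hn
  obtain ⟨C₁, hC₁, h₁⟩ := exists_halfCount_sub_sum_le k hn
  have hV := setIntegral_sqMonomial_mul_Gamma k
  have hV0 : 0 ≤ ∫ x in Metric.closedBall (0 : EuclideanSpace ℝ (Fin n)) 1, sqMonomial k x :=
    integral_nonneg (sqMonomial_nonneg k)
  set V := ∫ x in Metric.closedBall (0 : EuclideanSpace ℝ (Fin n)) 1, sqMonomial k x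
  have hM : (1 : ℝ) ≤ (∑ i, k i : ℕ) + (n : ℝ) / 2 := by
    have : (0 : ℝ) ≤ (∑ i, k i : ℕ) := by positivity
    linarith
  set M : ℝ := (∑ i, k i : ℕ) + (n : ℝ) / 2
  obtain ⟨C₂, hC₂, h₂⟩ := exists_mul_sum_sub_rpow_le (c := n / 4) (by positivity) hM
  have hΓ : (∏ i, Real.Gamma (k i + 1 / 2)) / Real.Gamma M = V * M := by
    have := Real.Gamma_pos_of_pos (s := M) (by linarith)
    rw [← hV, Real.Gamma_add_one (by positivity)]
    field_simp
  rw [hΓ] at h₁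
  refine ⟨C₁ + V * C₂, by positivity, fun N hN => ?_⟩
  have h3 := h₁ N hN
  have h4 := mul_le_mul_of_nonneg_left (h₂ N hN) hV0
  rw [← abs_of_nonneg hV0, ← abs_mul, abs_of_nonneg hV0] at h4
  calc _ = |(halfCount k N - V * M * ∑ j ∈ range (N + 1), ((j : ℝ) + n / 4) ^ (M - 1)) +
        V * (M * ∑ j ∈ range (N + 1), ((j : ℝ) + n / 4) ^ (M - 1) - (N : ℝ) ^ M)| := by
        congr 1
        ring
    _ ≤ C₁ * (N : ℝ) ^ (M - 1) + V * (C₂ * (N : ℝ) ^ (M - 1)) :=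
        (abs_add_le _ _).trans (add_le_add h3 h4)
    _ = _ := by ring

end BallMoments

section PolynomialCount

variable {n : ℕ}

lemma summable_halfWeight_of_le (k : Fin n → ℕ) (N : ℕ) :
    Summable fun b : Fin n → ℤ => if halfNorm b ≤ N then halfWeight k b else 0 := by
  have h := ((prod_halfTheta k (w := 1) (by simp)).1).mul_right (Real.exp (N + n / 4))
  refine Summable.of_nonneg_of_le (fun b => ?_) (fun b => ?_) h
  · split_ifs
    · exact halfWeight_nonneg k b
    · exact le_rfl
  · have h0 := halfWeight_nonneg k b
    split_ifs with hb
    · have hb' : (halfNorm b : ℝ) ≤ N := by exact_mod_cast hb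
      rw [mul_assoc, ← Real.exp_add, Complex.one_re]
      exact le_mul_of_one_le_right h0 (Real.one_le_exp (by linarith))
    · positivity

lemma eval_sq_eq_sum_sqMonomial (P : MvPolynomial (Fin n) ℝ) (x : EuclideanSpace ℝ (Fin n)) :
    MvPolynomial.eval (fun i => x i ^ 2) P = ∑ k ∈ P.support, P.coeff k * sqMonomial k x :=
  MvPolynomial.eval_eq' _ _

lemma tsum_eval_sq_eq_sum_halfCount (P : MvPolynomial (Fin n) ℝ) (N : ℕ) :
    (∑' b : Fin n → ℤ, if halfNorm b ≤ N then
        MvPolynomial.eval (fun i => ((b i : ℝ) + 1 / 2) ^ 2) P else 0) =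
      ∑ k ∈ P.support, P.coeff k * halfCount k N := by
  simp_rw [halfCount, ← tsum_mul_left]
  have hs : ∀ k ∈ P.support, Summable fun b : Fin n → ℤ =>
      P.coeff k * if halfNorm b ≤ N then halfWeight k b else 0 :=
    fun k _ => (summable_halfWeight_of_le k N).mul_left _
  rw [← Summable.tsum_finsetSum hs]
  refine tsum_congr fun b => ?_
  split_ifs
  · exact MvPolynomial.eval_eq' _ _
  · simp

lemma integral_eval_sq_eq_sum (P : MvPolynomial (Fin n) ℝ) :
    ∫ x in Metric.closedBall (0 : EuclideanSpace ℝ (Fin n)) 1,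
        MvPolynomial.eval (fun i => x i ^ 2) P =
      ∑ k ∈ P.support, P.coeff k *
        ∫ x in Metric.closedBall (0 : EuclideanSpace ℝ (Fin n)) 1, sqMonomial k x := by
  simp_rw [eval_sq_eq_sum_sqMonomial, ← integral_const_mul]
  refine integral_finsetSum _ fun k _ => Integrable.const_mul ?_ _
  exact (continuous_sqMonomial k).continuousOn.integrableOn_compact (isCompact_closedBall _ _)

/-- Sharp lattice point count weighted by a homogeneous polynomial in the squares of the
coordinates. -/
lemma exists_tsum_eval_sq_sub_rpow_le (hn : 5 ≤ n) {D : ℕ} {P : MvPolynomial (Fin n) ℝ}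
    (hP : P.IsHomogeneous D) : ∃ C : ℝ, 0 ≤ C ∧ ∀ N : ℕ, 0 < N →
      |(∑' b : Fin n → ℤ, if halfNorm b ≤ N then
          MvPolynomial.eval (fun i => ((b i : ℝ) + 1 / 2) ^ 2) P else 0) -
        (∫ x in Metric.closedBall (0 : EuclideanSpace ℝ (Fin n)) 1,
          MvPolynomial.eval (fun i => x i ^ 2) P) * (N : ℝ) ^ ((D : ℝ) + n / 2)| ≤
      C * (N : ℝ) ^ ((D : ℝ) + n / 2 - 1) := by
  choose! c hc0 hc using fun k : Fin n →₀ ℕ => exists_halfCount_sub_rpow_le (k : Fin n → ℕ) hn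
  refine ⟨∑ k ∈ P.support, |P.coeff k| * c k,
    Finset.sum_nonneg fun k _ => mul_nonneg (abs_nonneg _) (hc0 k), fun N hN => ?_⟩
  rw [tsum_eval_sq_eq_sum_halfCount, integral_eval_sq_eq_sum, Finset.sum_mul,
    ← Finset.sum_sub_distrib, Finset.sum_mul]
  refine (Finset.abs_sum_le_sum_abs _ _).trans (Finset.sum_le_sum fun k hk => ?_)
  have hD : ∑ i, k i = D := by
    rw [← hP (MvPolynomial.mem_support_iff.1 hk), Finsupp.weight_apply, Finsupp.sum_fintype] <;> simp
  have := hc k N hN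
  rw [hD] at this
  rw [mul_assoc, ← mul_sub, abs_mul, mul_assoc]
  exact mul_le_mul_of_nonneg_left this (abs_nonneg _)

lemma abs_rpow_sub_rpow_le {x y a M : ℝ} (hx : 1 ≤ x) (hy : 1 ≤ y) (h : |x - y| ≤ a)
    (hM : 1 ≤ M) :
    x ^ (M - 1) ≤ (1 + a) ^ (M - 1) * y ^ (M - 1) ∧
      |x ^ M - y ^ M| ≤ M * a * (1 + a) ^ (M - 1) * ((1 + a) ^ (M - 1) * y ^ (M - 1)) := by
  have ha : 0 ≤ a := (abs_nonneg _).trans h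
  have h1 : ∀ z : ℝ, 1 ≤ z → z ≤ y + a → z ^ (M - 1) ≤ (1 + a) ^ (M - 1) * y ^ (M - 1) := by
    intro z hz hzy
    rw [← Real.mul_rpow (by linarith) (by linarith)]
    exact Real.rpow_le_rpow (by linarith) (by nlinarith) (by linarith)
  have h2 := abs_le.1 h
  have h3 : 0 ≤ M * a * (1 + a) ^ (M - 1) := by positivity
  refine ⟨h1 x hx (by linarith), ?_⟩
  rcases le_total x y with hxy | hxy
  · have h4 := add_rpow_sub_rpow_le hx (sub_nonneg.2 hxy) (a := a) (by linarith) hM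
    rw [add_sub_cancel] at h4
    rw [abs_sub_comm, abs_of_nonneg (sub_nonneg.2 (Real.rpow_le_rpow (by linarith) hxy (by linarith)))]
    exact h4.trans (mul_le_mul_of_nonneg_left (h1 x hx (by linarith)) h3)
  · have h4 := add_rpow_sub_rpow_le hy (sub_nonneg.2 hxy) (a := a) (by linarith) hM
    rw [add_sub_cancel] at h4
    rw [abs_of_nonneg (sub_nonneg.2 (Real.rpow_le_rpow (by linarith) hxy (by linarith)))]
    exact h4.trans (mul_le_mul_of_nonneg_left (h1 y hy (by linarith)) h3)

lemma isBigO_tsum_eval_sq_sub_rpow (hn : 5 ≤ n) {D : ℕ} {P : MvPolynomial (Fin n) ℝ}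
    (hP : P.IsHomogeneous D) (R : ℝ) :
    (fun lam : ℝ => (∑' b : Fin n → ℤ, if ∑ i, ((b i : ℝ) + 1 / 2) ^ 2 ≤ lam + R then
          MvPolynomial.eval (fun i => ((b i : ℝ) + 1 / 2) ^ 2) P else 0) -
        (∫ x in Metric.closedBall (0 : EuclideanSpace ℝ (Fin n)) 1,
          MvPolynomial.eval (fun i => x i ^ 2) P) * lam ^ ((D : ℝ) + n / 2))
      =O[atTop] fun lam : ℝ => lam ^ ((D : ℝ) + n / 2 - 1) := by
  obtain ⟨C, hC0, hC⟩ := exists_tsum_eval_sq_sub_rpow_le hn hP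
  set V := ∫ x in Metric.closedBall (0 : EuclideanSpace ℝ (Fin n)) 1,
    MvPolynomial.eval (fun i => x i ^ 2) P
  have hn' : (5 : ℝ) ≤ n := by exact_mod_cast hn
  have hM : 1 ≤ (D : ℝ) + n / 2 := by
    have : (0 : ℝ) ≤ D := by positivity
    linarith
  set M : ℝ := (D : ℝ) + n / 2
  set a : ℝ := |R - n / 4| + 1
  refine IsBigO.of_bound (C * (1 + a) ^ (M - 1) +
    |V| * (M * a * (1 + a) ^ (M - 1) * (1 + a) ^ (M - 1))) ?_
  filter_upwards [eventually_ge_atTop (|R - n / 4| + 1)] with lam hlam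
  have hs := abs_le.1 (le_refl |R - n / 4|)
  have hpos : 0 ≤ lam + (R - n / 4) := by linarith
  have hN1 := Nat.floor_le hpos
  have hN2 := Nat.lt_floor_add_one (lam + (R - n / 4))
  have hN3 : 0 < ⌊lam + (R - n / 4)⌋₊ := Nat.floor_pos.2 (by linarith)
  have hcond : ∀ b : Fin n → ℤ, ∑ i, ((b i : ℝ) + 1 / 2) ^ 2 ≤ lam + R ↔
      halfNorm b ≤ ⌊lam + (R - n / 4)⌋₊ := fun b => by
    rw [← halfNorm_add, Nat.le_floor_iff hpos]
    constructor <;> intro h <;> linarith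
  simp_rw [hcond]
  set N := ⌊lam + (R - n / 4)⌋₊
  have hlam1 : 1 ≤ lam := by linarith [abs_nonneg (R - n / 4)]
  obtain ⟨h1, h2⟩ := abs_rpow_sub_rpow_le (x := N) (y := lam) (a := a) (M := M)
    (by exact_mod_cast hN3) hlam1 (abs_le.2 ⟨by linarith, by linarith⟩) hM
  rw [Real.norm_eq_abs, Real.norm_of_nonneg (by positivity)]
  calc |_ - V * lam ^ M| ≤ |_ - V * (N : ℝ) ^ M| + |V * ((N : ℝ) ^ M - lam ^ M)| := by
        refine le_of_eq_of_le ?_ (abs_add_le _ _)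
        congr 1
        ring
    _ ≤ C * ((1 + a) ^ (M - 1) * lam ^ (M - 1)) +
        |V| * (M * a * (1 + a) ^ (M - 1) * ((1 + a) ^ (M - 1) * lam ^ (M - 1))) := by
        rw [abs_mul]
        exact add_le_add ((hC N hN3).trans (mul_le_mul_of_nonneg_left h1 hC0))
          (mul_le_mul_of_nonneg_left h2 (abs_nonneg _))
    _ = _ := by ring

end PolynomialCount

section WeylPolynomial

/-- The numerator of the multiplicity polynomial, in the squares of the coordinates. -/
noncomputable def weylPolynomial (n : ℕ) : MvPolynomial (Fin n) ℝ :=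
  (∏ i, MvPolynomial.X i) * ∏ p ∈ Finset.univ.filter (fun p : Fin n × Fin n => p.1 < p.2),
    (MvPolynomial.X p.1 - MvPolynomial.X p.2) ^ 2

lemma card_filter_fst_lt_snd_mul_two (n : ℕ) :
    (Finset.univ.filter (fun p : Fin n × Fin n => p.1 < p.2)).card * 2 = n * (n - 1) := by
  rw [← Finset.sum_range_id_mul_two, Finset.card_eq_sum_ones, Finset.sum_filter,
    Fintype.sum_prod_type_right, ← Fin.sum_univ_eq_sum_range (fun i => i) n]
  congr 2
  ext j
  rw [← Finset.sum_filter, ← Finset.card_eq_sum_ones, ← Fin.card_Iio]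
  congr 1
  ext i
  simp

lemma isHomogeneous_weylPolynomial (n : ℕ) : (weylPolynomial n).IsHomogeneous (n ^ 2) := by
  have h1 : (∏ i : Fin n, MvPolynomial.X i : MvPolynomial (Fin n) ℝ).IsHomogeneous
      (∑ _i : Fin n, 1) :=
    MvPolynomial.IsHomogeneous.prod _ _ _ fun i _ => MvPolynomial.isHomogeneous_X _ _
  have h2 : (∏ p ∈ Finset.univ.filter (fun p : Fin n × Fin n => p.1 < p.2),
      (MvPolynomial.X p.1 - MvPolynomial.X p.2) ^ 2 : MvPolynomial (Fin n) ℝ).IsHomogeneous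
      (∑ _p ∈ Finset.univ.filter (fun p : Fin n × Fin n => p.1 < p.2), 1 * 2) :=
    MvPolynomial.IsHomogeneous.prod _ _ _ fun p _ =>
      ((MvPolynomial.isHomogeneous_X _ _).sub (MvPolynomial.isHomogeneous_X _ _)).pow 2
  unfold weylPolynomial
  convert h1.mul h2 using 1
  rw [Finset.sum_const, Finset.sum_const, smul_eq_mul, smul_eq_mul, one_mul,
    card_filter_fst_lt_snd_mul_two, Finset.card_univ, Fintype.card_fin]
  cases n
  · rfl
  · simp only [Nat.add_sub_cancel]
    ring

lemma eval_weylPolynomial {n : ℕ} (x : Fin n → ℝ) :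
    MvPolynomial.eval (fun i => x i ^ 2) (weylPolynomial n) =
      (∏ i, x i ^ 2) * ∏ p ∈ Finset.univ.filter (fun p : Fin n × Fin n => p.1 < p.2),
        (x p.1 ^ 2 - x p.2 ^ 2) ^ 2 := by
  simp [weylPolynomial]

end WeylPolynomial

/-- **Sharp Weyl law for SO(2n+1), rank n ≥ 5 (Theorem 5.1, odd orthogonal case).**
With `d = dim SO(2n+1) = n(2n+1)`, `ρ = (n−1/2, …, 1/2)`, `a_j = n−j+1/2`, the
multiplicity polynomial
`m(x) = (∏_i x_i²)∏_{i<l}(x_i²−x_l²)²/((∏_j a_j²)∏_{j<l}(a_j²−a_l²)²)`, and the spectral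
counting function `𝓝(λ) = (2ⁿ n!)⁻¹ Σ_{b∈ℤⁿ} m(b+ρ) 1_{|b+ρ|² ≤ λ+|ρ|²}`, one has
`𝓝(λ) = C λ^{d/2} + O(λ^{(d−2)/2})` where `C = (2ⁿ n!)⁻¹ ∫_{|x|≤1} m`. -/
theorem stmt11 (n : ℕ) (hn : 5 ≤ n) (d : ℕ) (hd : d = n * (2 * n + 1))
    (a : Fin n → ℝ) (ha : ∀ j, a j = (n : ℝ) - (j : ℕ) - 1 / 2)
    (ρ : EuclideanSpace ℝ (Fin n)) (hρ : ∀ j : Fin n, ρ j = (n : ℝ) - (j : ℕ) - 1 / 2)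
    (m : EuclideanSpace ℝ (Fin n) → ℝ)
    (hm : ∀ x, m x =
      ((∏ i, x i ^ 2) *
        ∏ p ∈ Finset.univ.filter (fun p : Fin n × Fin n => p.1 < p.2),
          (x p.1 ^ 2 - x p.2 ^ 2) ^ 2) /
      ((∏ j, a j ^ 2) *
        ∏ p ∈ Finset.univ.filter (fun p : Fin n × Fin n => p.1 < p.2),
          (a p.1 ^ 2 - a p.2 ^ 2) ^ 2))
    (𝓝 : ℝ → ℝ)
    (h𝓝 : ∀ lam : ℝ, 𝓝 lam = (1 / ((2 : ℝ) ^ n * n.factorial)) *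
      ∑' b : Fin n → ℤ,
        if ‖((EuclideanSpace.equiv (Fin n) ℝ).symm fun i => (b i : ℝ) + ρ i)‖ ^ 2
            ≤ lam + ‖ρ‖ ^ 2 then
          m ((EuclideanSpace.equiv (Fin n) ℝ).symm fun i => (b i : ℝ) + ρ i) else 0)
    (C : ℝ)
    (hC : C = (1 / ((2 : ℝ) ^ n * n.factorial)) *
      ∫ x in Metric.closedBall (0 : EuclideanSpace ℝ (Fin n)) 1, m x) :
    (fun lam : ℝ => 𝓝 lam - C * lam ^ ((d : ℝ) / 2))
      =O[atTop] (fun lam : ℝ => lam ^ (((d : ℝ) - 2) / 2)) := by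
  set κ : ℝ := 1 / ((2 : ℝ) ^ n * n.factorial)
  set c : ℝ := (∏ j, a j ^ 2) *
    ∏ p ∈ Finset.univ.filter (fun p : Fin n × Fin n => p.1 < p.2), (a p.1 ^ 2 - a p.2 ^ 2) ^ 2
  have hm' : ∀ x : EuclideanSpace ℝ (Fin n),
      m x = MvPolynomial.eval (fun i => x i ^ 2) (weylPolynomial n) * c⁻¹ := fun x => by
    rw [hm, eval_weylPolynomial, div_eq_mul_inv]
  have hcount : ∀ lam, 𝓝 lam = κ * c⁻¹ * ∑' b : Fin n → ℤ,
      if ∑ i, ((b i : ℝ) + 1 / 2) ^ 2 ≤ lam + ‖ρ‖ ^ 2 then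
        MvPolynomial.eval (fun i => ((b i : ℝ) + 1 / 2) ^ 2) (weylPolynomial n) else 0 := by
    intro lam
    rw [h𝓝, mul_assoc]
    congr 1
    rw [← tsum_mul_left,
      ← (Equiv.addRight fun i : Fin n => (n : ℤ) - (i : ℕ) - 1).tsum_eq fun b : Fin n → ℤ =>
        c⁻¹ * if ∑ i, ((b i : ℝ) + 1 / 2) ^ 2 ≤ lam + ‖ρ‖ ^ 2 then
          MvPolynomial.eval (fun i => ((b i : ℝ) + 1 / 2) ^ 2) (weylPolynomial n) else 0]
    refine tsum_congr fun b => ?_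
    have hb : ∀ i : Fin n, (b i : ℝ) + ρ i =
        (((Equiv.addRight fun i : Fin n => (n : ℤ) - (i : ℕ) - 1) b i : ℤ) : ℝ) + 1 / 2 := by
      intro i
      rw [hρ, Equiv.coe_addRight]
      dsimp only [Pi.add_apply]
      push_cast
      ring
    simp_rw [hm', EuclideanSpace.norm_sq_eq, Real.norm_eq_abs, sq_abs,
      PiLp.continuousLinearEquiv_symm_apply, hb, mul_ite, mul_zero, mul_comm c⁻¹]
  have hI : C = κ * c⁻¹ * ∫ x in Metric.closedBall (0 : EuclideanSpace ℝ (Fin n)) 1,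
      MvPolynomial.eval (fun i => x i ^ 2) (weylPolynomial n) := by
    simp_rw [hC, hm', integral_mul_const]
    ring
  have hd' : (d : ℝ) / 2 = ((n ^ 2 : ℕ) : ℝ) + n / 2 := by
    rw [hd]
    push_cast
    ring
  have key := (isBigO_tsum_eval_sq_sub_rpow hn (isHomogeneous_weylPolynomial n)
    (‖ρ‖ ^ 2)).const_mul_left (κ * c⁻¹)
  simp_rw [hcount, hI, sub_div, hd', div_self (two_ne_zero' ℝ), mul_assoc (κ * c⁻¹), ← mul_sub]
  exact key
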